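/- arXiv:0812.0598 — 2 statements merged into one kernel-verified Lean document; each statement's English description precedes it below -/
import Mathlib

section
/- Every k-player matrix game (finite strategy sets, real-valued utilities) has a personalized equilibrium: there exist probability distributions p₁,...,p_k over the respective strategy sets such that for each player i, p_i together with some optimal fractional hypergraph matching w_i maximizes player i's personalized payoff given p_{-i}. -/
attribute [local instance] Classical.propDecidable

/-- A probability distribution on a finite type. -/
def IsDist {β : Type*} [Fintype β] (p : β → ℝ) : Prop :=
  (∀ s, 0 ≤ p s) ∧ ∑ s, p s = 1

variable {k : ℕ} {S : Fin k → Type*} [∀ j, Fintype (S j)]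

/-- Player `i`'s personalized payoff given utility `u` (over strategy
profiles) and the profile `p` of distributions: the maximum of
`∑_e w(e)·u(e)` over all fractional hypergraph matchings `w` whose marginal on
every strategy `s ∈ S j` equals `p j s`. -/
noncomputable def ppayoff (u : (∀ j, S j) → ℝ) (p : ∀ j, S j → ℝ) : ℝ :=
  sSup {v : ℝ | ∃ w : (∀ j, S j) → ℝ,
    (∀ e, 0 ≤ w e) ∧
    (∀ (j : Fin k) (s : S j),
      ∑ e ∈ Finset.univ.filter (fun e : ∀ j, S j => e j = s), w e = p j s) ∧
    v = ∑ e, w e * u e}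

/-- A personalized equilibrium: a profile of distributions such that each
player's distribution maximizes her personalized payoff given the others. -/
def PersonalizedEq (u : ∀ _ : Fin k, (∀ j, S j) → ℝ) (p : ∀ j, S j → ℝ) : Prop :=
  (∀ j, IsDist (p j)) ∧
    ∀ (i : Fin k) (q : S i → ℝ), IsDist q →
      ppayoff (u i) (Function.update p i q) ≤ ppayoff (u i) p

namespace PersEq

/-! ### Combinatorial core (Scarf) -/

/-- `B` is dominant for the family of rankings `r`. -/
def Dom {X I : Type*} (r : I → X → ℕ) (B : Finset X) : Prop :=
  ∀ y, ∃ i, ∀ b ∈ B, r i y ≤ r i b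

/-- A dominant set with one element fewer than the number of rankings has exactly two
dominant one-point extensions (under a non-degeneracy condition). -/
theorem door_count {X I : Type*} [Fintype X] [Fintype I] (r : I → X → ℕ)
    (hinj : ∀ i, Function.Injective (r i)) (A : Finset X) (hA : A.Nonempty)
    (hcard : A.card + 1 = Fintype.card I) (hd : Dom r A)
    (hne : ∀ i, ∃ z, ∀ j, j ≠ i → ∃ x ∈ A, r j x < r j z) :
    (Finset.univ.filter (fun y => y ∉ A ∧ Dom r (insert y A))).card = 2 := by
  have hm : ∀ i, ∃ x ∈ A, ∀ b ∈ A, r i x ≤ r i b := fun i => A.exists_min_image (r i) hA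
  choose m hmA hmin using hm
  -- surjectivity
  have hsurj : ∀ x ∈ A, ∃ i, m i = x := by
    intro x hx
    obtain ⟨i, hi⟩ := hd x
    exact ⟨i, hinj i (le_antisymm (hmin i x hx) (hi _ (hmA i)))⟩
  obtain ⟨a, -, b, -, hab, hmab⟩ : ∃ a ∈ (Finset.univ : Finset I), ∃ b ∈ (Finset.univ : Finset I),
      a ≠ b ∧ m a = m b := by
    apply Finset.exists_ne_map_eq_of_card_lt_of_maps_to (t := A)
    · rw [Finset.card_univ]; omega
    · intro i _; exact hmA i
  -- if J maps onto A then J misses at most one point and m is injective on J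
  have key : ∀ i, (∀ x ∈ A, ∃ j, j ≠ i ∧ m j = x) → i = a ∨ i = b := by
    intro i hi
    by_contra hcon
    push Not at hcon
    have h1 : A ⊆ ((Finset.univ.erase i).erase a).image m := by
      intro x hx
      obtain ⟨j, hj, rfl⟩ := hi x hx
      rw [Finset.mem_image]
      by_cases hja : j = a
      · subst hja
        exact ⟨b, by simp [hab.symm, hcon.2.symm], hmab.symm⟩
      · exact ⟨j, by simp [hj, hja], rfl⟩
    have h2 := (Finset.card_le_card h1).trans Finset.card_image_le
    rw [Finset.card_erase_of_mem (by simp [hcon.1.symm]), Finset.card_erase_of_mem (by simp),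
      Finset.card_univ] at h2
    have := hA.card_pos
    omega
  have sj : ∀ i, i = a ∨ i = b → ∀ x ∈ A, ∃ j, j ≠ i ∧ m j = x := by
    intro i hi x hx
    obtain ⟨j, rfl⟩ := hsurj x hx
    by_cases hj : j = i
    · subst hj
      rcases hi with rfl | rfl
      · exact ⟨b, hab.symm, hmab.symm⟩
      · exact ⟨a, hab, hmab⟩
    · exact ⟨j, hj, rfl⟩
  have hM : ∀ i, ∃ y, (∀ j, j ≠ i → r j (m j) < r j y) ∧
      ∀ z, (∀ j, j ≠ i → r j (m j) < r j z) → r i z ≤ r i y := by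
    intro i
    obtain ⟨z, hz⟩ := hne i
    have hz' : ∀ j, j ≠ i → r j (m j) < r j z := by
      intro j hj
      obtain ⟨x, hx, hlt⟩ := hz j hj
      exact (hmin j x hx).trans_lt hlt
    obtain ⟨y, hy, hmax⟩ := (Finset.univ.filter
      (fun z => ∀ j, j ≠ i → r j (m j) < r j z)).exists_max_image (r i) ⟨z, by simpa using hz'⟩
    refine ⟨y, by simpa using hy, fun w hw => hmax w (by simpa using hw)⟩
  choose Y hY hYmax using hM
  have hYne : Y a ≠ Y b := by
    intro h
    obtain ⟨i, hi⟩ := hd (Y a)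
    have h3 := hi _ (hmA i)
    by_cases hia : i = a
    · subst hia
      have := hY b i hab
      rw [← h] at this
      omega
    · have := hY a i hia
      omega
  rw [Finset.card_eq_two]
  refine ⟨Y a, Y b, hYne, ?_⟩
  ext y
  simp only [Finset.mem_filter, Finset.mem_univ, true_and, Finset.mem_insert,
    Finset.mem_singleton]
  constructor
  · rintro ⟨hyA, hdy⟩
    obtain ⟨i, hi⟩ := hdy y
    have hJ : ∀ x ∈ A, ∃ j, m j = x ∧ r j (m j) < r j y := by
      intro x hx
      obtain ⟨j, hj⟩ := hdy x
      have hxm : m j = x :=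
        hinj j (le_antisymm (hmin j x hx) (hj _ (Finset.mem_insert_of_mem (hmA j))))
      refine ⟨j, hxm, ?_⟩
      rw [hxm]
      refine lt_of_le_of_ne (hj _ (Finset.mem_insert_self _ _)) fun h => ?_
      exact hyA (hinj j h ▸ hx)
    have hiJ : ¬ r i (m i) < r i y := not_lt.2 (hi _ (Finset.mem_insert_of_mem (hmA i)))
    have hiab : i = a ∨ i = b := by
      apply key
      intro x hx
      obtain ⟨j, hj, hlt⟩ := hJ x hx
      exact ⟨j, fun h => hiJ (h ▸ hlt), hj⟩
    -- all other indices belong to J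
    have hall : ∀ j, j ≠ i → r j (m j) < r j y := by
      intro l hl
      by_contra hcon
      have h1 : A ⊆ ((Finset.univ.erase i).erase l).image m := by
        intro x hx
        obtain ⟨j, hj, hlt⟩ := hJ x hx
        rw [Finset.mem_image]
        refine ⟨j, ?_, hj⟩
        simp only [Finset.mem_erase, Finset.mem_univ, and_true]
        exact ⟨fun h => hcon (h ▸ hlt), fun h => hiJ (h ▸ hlt)⟩
      have h2 := (Finset.card_le_card h1).trans Finset.card_image_le
      rw [Finset.card_erase_of_mem (by simp [hl]), Finset.card_erase_of_mem (by simp),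
        Finset.card_univ] at h2
      have := hA.card_pos
      omega
    have hyY : y = Y i := by
      apply hinj i
      apply le_antisymm (hYmax i y hall)
      obtain ⟨j, hj⟩ := hdy (Y i)
      by_cases hji : j = i
      · subst hji; exact hj _ (Finset.mem_insert_self _ _)
      · have h1 := hY i j hji
        have h2 := hj _ (Finset.mem_insert_of_mem (hmA j))
        omega
    rcases hiab with rfl | rfl
    · exact Or.inl hyY
    · exact Or.inr hyY
  · intro hy
    obtain ⟨i, hi, rfl⟩ : ∃ i, (i = a ∨ i = b) ∧ y = Y i := by
      rcases hy with h | h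
      · exact ⟨a, Or.inl rfl, h⟩
      · exact ⟨b, Or.inr rfl, h⟩
    have hlow : r i (Y i) ≤ r i (m i) := by
      obtain ⟨j, hj⟩ := hd (Y i)
      by_cases hji : j = i
      · subst hji; exact hj _ (hmA _)
      · have h1 := hY i j hji
        have h2 := hj _ (hmA j)
        omega
    constructor
    · intro hmem
      obtain ⟨j, hj, hjm⟩ := sj i hi _ hmem
      have := hY i j hj
      rw [hjm] at this
      omega
    · intro z
      by_cases hz : ∀ j, j ≠ i → r j (m j) < r j z
      · refine ⟨i, fun w hw => ?_⟩
        rcases Finset.mem_insert.1 hw with rfl | hw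
        · exact hYmax i z hz
        · exact (hYmax i z hz).trans (hlow.trans (hmin i w hw))
      · push Not at hz
        obtain ⟨j, hj, hle⟩ := hz
        refine ⟨j, fun w hw => ?_⟩
        rcases Finset.mem_insert.1 hw with rfl | hw
        · exact hle.trans (hY i j hj).le
        · exact hle.trans (hmin j w hw)

/-- A set with as many elements as colours, not using every colour, has an even number of
elements whose deletion leaves exactly the colours different from `i₀`. -/
theorem room_count {X I : Type*} [Fintype I] (c : X → I) (i₀ : I) (B : Finset X)
    (hcard : B.card = Fintype.card I) (hB : B.image c ≠ Finset.univ) :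
    Even (B.filter (fun y => (B.erase y).image c = Finset.univ.erase i₀)).card := by
  rcases (B.filter (fun y => (B.erase y).image c = Finset.univ.erase i₀)).eq_empty_or_nonempty
    with h | ⟨y, hy⟩
  · rw [h]; simp
  rw [Finset.mem_filter] at hy
  obtain ⟨hyB, hyc⟩ := hy
  have hinj : ∀ z ∈ B, (B.erase z).image c = Finset.univ.erase i₀ →
      Set.InjOn c (B.erase z : Finset X) := by
    intro z hz hzc
    apply Finset.injOn_of_card_image_eq
    rw [hzc, Finset.card_erase_of_mem (Finset.mem_univ _), Finset.card_erase_of_mem hz, hcard,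
      Finset.card_univ]
  have hBc : B.image c = insert (c y) (Finset.univ.erase i₀) := by
    rw [← hyc, ← Finset.image_insert, Finset.insert_erase hyB]
  have hcy : c y ≠ i₀ := by
    intro h
    apply hB
    rw [hBc, h, Finset.insert_erase (Finset.mem_univ _)]
  have : c y ∈ (B.erase y).image c := by rw [hyc]; simp [hcy]
  obtain ⟨x, hx, hxy⟩ := Finset.mem_image.1 this
  have hxB := Finset.mem_of_mem_erase hx
  have hxne := Finset.ne_of_mem_erase hx
  have heq : B.filter (fun y => (B.erase y).image c = Finset.univ.erase i₀) = {y, x} := by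
    ext z
    simp only [Finset.mem_filter, Finset.mem_insert, Finset.mem_singleton]
    constructor
    · rintro ⟨hz, hzc⟩
      by_contra hcon
      push Not at hcon
      exact hxne (hinj z hz hzc (by simp [hxB, hcon.2.symm]) (by simp [hyB, hcon.1.symm]) hxy)
    · rintro (rfl | rfl)
      · exact ⟨hyB, hyc⟩
      · refine ⟨hxB, ?_⟩
        rw [← hyc]
        ext i
        simp only [Finset.mem_image, Finset.mem_erase]
        constructor
        · rintro ⟨w, ⟨hw, hwB⟩, rfl⟩
          by_cases hwy : w = y
          · subst hwy; exact ⟨z, ⟨hxne, hxB⟩, hxy⟩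
          · exact ⟨w, ⟨hwy, hwB⟩, rfl⟩
        · rintro ⟨w, ⟨hw, hwB⟩, rfl⟩
          by_cases hwz : w = z
          · subst hwz; exact ⟨y, ⟨hxne.symm, hyB⟩, hxy.symm⟩
          · exact ⟨w, ⟨hwz, hwB⟩, rfl⟩
  rw [heq, Finset.card_pair hxne.symm]
  exact even_two

/-- Scarf-type lemma with slack elements. -/
theorem scarf {X I : Type*} [Fintype X] [Fintype I] [Nonempty I] (r : I → X → ℕ)
    (hinj : ∀ i, Function.Injective (r i)) (s : I → X) (c : X → I) (hcs : ∀ i, c (s i) = i)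
    (hmin : ∀ i x, r i (s i) ≤ r i x)
    (hbig : ∀ i j x, i ≠ j → x ∉ Set.range s → r i x < r i (s j))
    (t : X) (ht : t ∉ Set.range s) :
    ∃ B : Finset X, B.card = Fintype.card I ∧ Dom r B ∧ B.image c = Finset.univ := by
  by_contra hcon
  push Not at hcon
  obtain ⟨i₀⟩ := ‹Nonempty I›
  have hn : 0 < Fintype.card I := Fintype.card_pos_iff.2 ⟨i₀⟩
  have hsinj : Function.Injective s := fun i j h => by rw [← hcs i, h, hcs]
  set Doors : Finset (Finset X) := Finset.univ.filter
    (fun A => A.image c = Finset.univ.erase i₀ ∧ A.card + 1 = Fintype.card I) with hDoors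
  set Rooms : Finset (Finset X) := Finset.univ.filter
    (fun B => B.card = Fintype.card I ∧ Dom r B) with hRooms
  have hdc := Finset.sum_card_bipartiteAbove_eq_sum_card_bipartiteBelow
    (s := Doors) (t := Rooms) (fun A B : Finset X => A ⊆ B)
  -- rooms
  have hR : Even (∑ B ∈ Rooms, (Doors.bipartiteBelow (fun A B : Finset X => A ⊆ B) B).card) := by
    apply Finset.even_sum
    intro B hB
    rw [hRooms, Finset.mem_filter] at hB
    obtain ⟨-, hBc, hBd⟩ := hB
    have := room_count c i₀ B hBc (hcon B hBc hBd)
    suffices heq : (B.filter (fun y => (B.erase y).image c = Finset.univ.erase i₀)).card =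
        (Doors.bipartiteBelow (fun A B : Finset X => A ⊆ B) B).card by
      rw [← heq]; exact this
    apply Finset.card_bij (fun y _ => B.erase y)
    · intro y hy
      rw [Finset.mem_filter] at hy
      rw [Finset.mem_bipartiteBelow, hDoors, Finset.mem_filter]
      refine ⟨⟨Finset.mem_univ _, hy.2, ?_⟩, Finset.erase_subset _ _⟩
      rw [Finset.card_erase_of_mem hy.1]; omega
    · intro y hy z hz h
      rw [Finset.mem_filter] at hy hz
      by_contra hne
      have : y ∈ B.erase z := by simp [hne, hy.1]
      rw [← h] at this
      simp at this
    · intro A hA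
      rw [Finset.mem_bipartiteBelow, hDoors, Finset.mem_filter] at hA
      obtain ⟨⟨-, hAc, hAn⟩, hAB⟩ := hA
      obtain ⟨y, hy, rfl⟩ : ∃ y, y ∉ A ∧ insert y A = B :=
        Finset.exists_eq_insert_iff.2 ⟨hAB, by omega⟩
      refine ⟨y, ?_, Finset.erase_insert hy⟩
      rw [Finset.mem_filter, Finset.erase_insert hy]
      exact ⟨Finset.mem_insert_self _ _, hAc⟩
  -- doors
  have hDcard : ∀ A ∈ Doors, (Rooms.bipartiteAbove (fun A B : Finset X => A ⊆ B) A).card =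
      (Finset.univ.filter (fun y => y ∉ A ∧ Dom r (insert y A))).card := by
    intro A hA
    rw [hDoors, Finset.mem_filter] at hA
    obtain ⟨-, hAc, hAn⟩ := hA
    symm
    apply Finset.card_bij (fun y _ => insert y A)
    · intro y hy
      simp only [Finset.mem_filter, Finset.mem_univ, true_and] at hy
      rw [Finset.mem_bipartiteAbove, hRooms, Finset.mem_filter]
      refine ⟨⟨Finset.mem_univ _, ?_, hy.2⟩, Finset.subset_insert _ _⟩
      rw [Finset.card_insert_of_notMem hy.1, hAn]
    · intro y hy z hz h
      simp only [Finset.mem_filter, Finset.mem_univ, true_and] at hy hz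
      have : y ∈ insert z A := h ▸ Finset.mem_insert_self _ _
      rcases Finset.mem_insert.1 this with h | h
      · exact h
      · exact absurd h hy.1
    · intro B hB
      rw [Finset.mem_bipartiteAbove, hRooms, Finset.mem_filter] at hB
      obtain ⟨⟨-, hBn, hBd⟩, hAB⟩ := hB
      obtain ⟨y, hy, rfl⟩ : ∃ y, y ∉ A ∧ insert y A = B :=
        Finset.exists_eq_insert_iff.2 ⟨hAB, by omega⟩
      exact ⟨y, by simp [hy, hBd], rfl⟩
  set A₀ : Finset X := (Finset.univ.erase i₀).image s with hA₀
  have hA₀D : A₀ ∈ Doors := by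
    rw [hDoors, Finset.mem_filter]
    refine ⟨Finset.mem_univ _, ?_, ?_⟩
    · rw [hA₀, Finset.image_image]
      have : c ∘ s = id := funext hcs
      rw [this, Finset.image_id]
    · rw [hA₀, Finset.card_image_of_injective _ hsinj, Finset.card_erase_of_mem (Finset.mem_univ _),
        Finset.card_univ]
      omega
  have hA₀1 : (Finset.univ.filter (fun y => y ∉ A₀ ∧ Dom r (insert y A₀))).card = 1 := by
    obtain ⟨y₀, hy₀, hmax⟩ := (Finset.univ.filter (fun y => y ∉ Set.range s)).exists_max_image (r i₀)
      ⟨t, by simpa using ht⟩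
    simp only [Finset.mem_filter, Finset.mem_univ, true_and] at hy₀ hmax
    rw [Finset.card_eq_one]
    refine ⟨y₀, ?_⟩
    ext y
    simp only [Finset.mem_filter, Finset.mem_univ, true_and, Finset.mem_singleton]
    constructor
    · rintro ⟨hyA, hd⟩
      have hT : ∀ z, z ∉ Set.range s → r i₀ z ≤ r i₀ y := by
        intro z hz
        obtain ⟨j, hj⟩ := hd z
        by_cases hji : j = i₀
        · subst hji; exact hj _ (Finset.mem_insert_self _ _)
        · have h1 := hj (s j) (Finset.mem_insert_of_mem
            (by rw [hA₀]; exact Finset.mem_image_of_mem _ (by simp [hji])))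
          have := hinj j (le_antisymm h1 (hmin j z))
          exact absurd ⟨j, this.symm⟩ hz
      have hyr : y ∉ Set.range s := by
        rintro ⟨j, rfl⟩
        by_cases hji : j = i₀
        · subst hji
          have := hinj j (le_antisymm (hT t ht) (hmin j t))
          exact ht ⟨j, this.symm⟩
        · exact hyA (by rw [hA₀]; exact Finset.mem_image_of_mem _ (by simp [hji]))
      exact hinj i₀ (le_antisymm (hmax y hyr) (hT y₀ hy₀))
    · rintro rfl
      refine ⟨?_, ?_⟩
      · rw [hA₀, Finset.mem_image]
        rintro ⟨j, -, rfl⟩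
        exact hy₀ ⟨j, rfl⟩
      · intro z
        by_cases hz : z ∈ Set.range s
        · obtain ⟨j, rfl⟩ := hz
          exact ⟨j, fun b _ => hmin j b⟩
        · refine ⟨i₀, fun b hb => ?_⟩
          rcases Finset.mem_insert.1 hb with rfl | hb
          · exact hmax z hz
          · rw [hA₀, Finset.mem_image] at hb
            obtain ⟨j, hj, rfl⟩ := hb
            exact (hbig i₀ j z (by simpa using (Finset.ne_of_mem_erase hj).symm) hz).le
  have hEv : ∀ A ∈ Doors.erase A₀,
      Even (Finset.univ.filter (fun y => y ∉ A ∧ Dom r (insert y A))).card := by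
    intro A hA
    obtain ⟨hne, hA⟩ := Finset.mem_erase.1 hA
    rw [hDoors, Finset.mem_filter] at hA
    obtain ⟨-, hAc, hAn⟩ := hA
    have hx : ∃ x ∈ A, x ∉ Set.range s := by
      by_contra hall
      push Not at hall
      apply hne
      ext x
      rw [hA₀, Finset.mem_image]
      constructor
      · intro hx
        obtain ⟨j, rfl⟩ := hall x hx
        refine ⟨j, ?_, rfl⟩
        rw [← hAc, Finset.mem_image]
        exact ⟨_, hx, hcs j⟩
      · rintro ⟨j, hj, rfl⟩
        rw [← hAc, Finset.mem_image] at hj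
        obtain ⟨x, hx, hxj⟩ := hj
        obtain ⟨l, rfl⟩ := hall x hx
        rw [hcs] at hxj
        exact hxj ▸ hx
    obtain ⟨x, hxA, hxs⟩ := hx
    by_cases hd : Dom r A
    · rw [door_count r hinj A ⟨x, hxA⟩ hAn hd
        (fun i => ⟨s i, fun j hj => ⟨x, hxA, hbig j i x hj hxs⟩⟩)]
      exact even_two
    · have : Finset.univ.filter (fun y => y ∉ A ∧ Dom r (insert y A)) = ∅ := by
        apply Finset.filter_eq_empty_iff.2
        rintro y - ⟨-, h⟩
        apply hd
        intro z
        obtain ⟨i, hi⟩ := h z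
        exact ⟨i, fun b hb => hi b (Finset.mem_insert_of_mem hb)⟩
      rw [this]; simp
  rw [Finset.sum_congr rfl hDcard, ← Finset.add_sum_erase _ _ hA₀D, hA₀1] at hdc
  rw [← hdc] at hR
  have h2 := Finset.even_sum _ hEv
  rw [Nat.even_add] at hR
  exact absurd (hR.2 h2) (by decide)

/-- Scarf's lemma on the integer points of a dilated simplex. -/
theorem grid {ι : Type*} [Fintype ι] [Nonempty ι] (N : ℕ) (c : (ι → ℕ) → ι) :
    ∃ z : ι → ℕ, ∑ j, z j = N ∧ ∀ i, z i ≤ Fintype.card ι ∨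
      ∃ y : ι → ℕ, ∑ j, y j = N ∧ c y = i ∧
        ∀ j, z j ≤ y j + Fintype.card ι ∧ y j ≤ z j + Fintype.card ι := by
  set T := ↥(Finset.piAntidiag (Finset.univ : Finset ι) N)
  have hTs : ∀ x : T, ∑ j, x.1 j = N := fun x => (Finset.mem_piAntidiag.1 x.2).1
  have hT : ∀ x : ι → ℕ, ∑ j, x j = N → x ∈ Finset.piAntidiag (Finset.univ : Finset ι) N :=
    fun x hx => Finset.mem_piAntidiag.2 ⟨hx, fun _ _ => Finset.mem_univ _⟩
  have hTle : ∀ (x : T) i, x.1 i ≤ N := fun x i =>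
    (Finset.single_le_sum (f := x.1) (fun _ _ => Nat.zero_le _) (Finset.mem_univ i)).trans_eq
      (hTs x)
  obtain ⟨K, ⟨e⟩⟩ := Finite.exists_equiv_fin T
  obtain ⟨L, ⟨e'⟩⟩ := Finite.exists_equiv_fin ι
  let r : ι → T ⊕ ι → ℕ := fun i => Sum.elim (fun x => 1 + (x.1 i * K + (e x).1))
    (fun j => if j = i then 0 else 1 + ((N + 1) * K + (e' j).1))
  have hlt : ∀ (x : T) i, x.1 i * K + (e x).1 < (N + 1) * K := by
    intro x i
    have h1 := (e x).2
    have h2 := Nat.mul_le_mul_right K (hTle x i)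
    rw [Nat.add_mul]
    omega
  have hmono : ∀ (x y : T) i, r i (Sum.inl x) ≤ r i (Sum.inl y) → x.1 i ≤ y.1 i := by
    intro x y i h
    simp only [r, Sum.elim_inl] at h
    by_contra hcon
    push Not at hcon
    have h1 := (e y).2
    have h2 := Nat.mul_le_mul_right K (Nat.succ_le_of_lt hcon)
    rw [Nat.succ_mul] at h2
    omega
  have hinj : ∀ i, Function.Injective (r i) := by
    intro i a b hab
    rcases a with x | a <;> rcases b with y | b
    · have h1 := le_antisymm (hmono x y i hab.le) (hmono y x i hab.ge)
      simp only [r, Sum.elim_inl, h1] at hab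
      congr 1
      apply e.injective
      apply Fin.ext
      omega
    · simp only [r, Sum.elim_inl, Sum.elim_inr] at hab
      have := hlt x i
      split_ifs at hab <;> omega
    · simp only [r, Sum.elim_inl, Sum.elim_inr] at hab
      have := hlt y i
      split_ifs at hab <;> omega
    · simp only [r, Sum.elim_inr] at hab
      congr 1
      split_ifs at hab with h1 h2 h2
      · rw [h1, h2]
      · omega
      · omega
      · apply e'.injective
        apply Fin.ext
        omega
  obtain ⟨i₁⟩ := ‹Nonempty ι›
  have : Nonempty ι := ⟨i₁⟩
  obtain ⟨B, hBc, hBd, hBim⟩ := scarf r hinj Sum.inr (Sum.elim (fun x => c x.1) id)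
    (fun i => rfl) (fun i x => by simp [r])
    (by
      rintro i j (x | x) hij hx
      · simp only [r, Sum.elim_inl, Sum.elim_inr]
        rw [if_neg hij.symm]
        have := hlt x i
        omega
      · exact absurd ⟨x, rfl⟩ hx)
    (Sum.inl ⟨Pi.single i₁ N, hT _ (by simp)⟩) (by simp)
  set C : Finset ι := Finset.univ.filter (fun i => (Sum.inr i : T ⊕ ι) ∉ B) with hC
  have hcol : ∀ i ∈ C, ∃ x : T, Sum.inl x ∈ B ∧ c x.1 = i := by
    intro i hi
    have : i ∈ B.image (Sum.elim (fun x => c x.1) id) := by rw [hBim]; simp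
    obtain ⟨b, hb, hbi⟩ := Finset.mem_image.1 this
    rcases b with x | j
    · exact ⟨x, hb, hbi⟩
    · simp only [Sum.elim_inr, id] at hbi
      subst hbi
      exact absurd hb (Finset.mem_filter.1 hi).2
  have hdom : ∀ y : T, ∃ i ∈ C, ∀ x : T, Sum.inl x ∈ B → y.1 i ≤ x.1 i := by
    intro y
    obtain ⟨i, hi⟩ := hBd (Sum.inl y)
    refine ⟨i, ?_, fun x hx => hmono y x i (hi _ hx)⟩
    rw [hC, Finset.mem_filter]
    refine ⟨Finset.mem_univ _, fun h => ?_⟩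
    have := hi _ h
    simp [r] at this
  obtain ⟨i₂, hi₂, -⟩ := hdom ⟨Pi.single i₁ N, hT _ (by simp)⟩
  obtain ⟨z, hzB, -⟩ := hcol i₂ hi₂
  have hm : ∀ i, ∃ x : T, Sum.inl x ∈ B ∧ ∀ y : T, Sum.inl y ∈ B → x.1 i ≤ y.1 i := by
    intro i
    obtain ⟨x, hx, hmin⟩ := (Finset.univ.filter (fun x : T => Sum.inl x ∈ B)).exists_min_image
      (fun x => x.1 i) ⟨z, by simpa using hzB⟩
    exact ⟨x, by simpa using hx, fun y hy => hmin y (by simpa using hy)⟩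
  choose m hmB hmin using hm
  have hsum : N < ∑ i ∈ C, ((m i).1 i + 1) := by
    by_contra hcon
    push Not at hcon
    set y : ι → ℕ := fun i => (if i ∈ C then (m i).1 i + 1 else 0) +
      (if i = i₂ then N - ∑ i ∈ C, ((m i).1 i + 1) else 0) with hy
    have hys : ∑ i, y i = N := by
      rw [hy, Finset.sum_add_distrib, Finset.sum_ite_mem, Finset.univ_inter]
      simp only [Finset.sum_ite_eq', Finset.mem_univ, if_true]
      omega
    obtain ⟨i, hiC, hi⟩ := hdom ⟨y, hT y hys⟩
    have := hi (m i) (hmB i)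
    simp only [hy, if_pos hiC] at this
    omega
  rw [Finset.sum_add_distrib, Finset.sum_const, smul_eq_mul, mul_one] at hsum
  have hCn : C.card ≤ Fintype.card ι := Finset.card_le_univ C
  -- all points of `B` are close to `m`
  have hclose : ∀ x : T, Sum.inl x ∈ B → ∀ i,
      x.1 i ≤ (if i ∈ C then (m i).1 i else 0) + Fintype.card ι := by
    intro x hx i
    have h1 : ∀ j, (if j ∈ C then (m j).1 j else 0) ≤ x.1 j := by
      intro j
      split_ifs
      · exact hmin j x hx
      · exact Nat.zero_le _
    have h2 := hTs x
    have h3 : ∑ j, (if j ∈ C then (m j).1 j else 0) = ∑ j ∈ C, (m j).1 j := by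
      rw [Finset.sum_ite_mem, Finset.univ_inter]
    rw [← Finset.add_sum_erase _ _ (Finset.mem_univ i)] at h2 h3
    have h4 := Finset.sum_le_sum (s := Finset.univ.erase i) (fun j _ => h1 j)
    omega
  have hlow : ∀ x : T, Sum.inl x ∈ B → ∀ i, (if i ∈ C then (m i).1 i else 0) ≤ x.1 i := by
    intro x hx j
    split_ifs
    · exact hmin j x hx
    · exact Nat.zero_le _
  refine ⟨z.1, hTs z, fun i => ?_⟩
  by_cases hi : i ∈ C
  · right
    obtain ⟨y, hyB, hyc⟩ := hcol i hi
    refine ⟨y.1, hTs y, hyc, fun j => ?_⟩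
    have h1 := hclose y hyB j
    have h2 := hclose z hzB j
    have h3 := hlow y hyB j
    have h4 := hlow z hzB j
    constructor <;> omega
  · left
    have := hclose z hzB i
    simpa [hi] using this

/-- A KKM-type covering lemma. -/
theorem kkm {ι : Type*} [Fintype ι] [Nonempty ι] (F : ι → Set (ι → ℝ))
    (hF : ∀ i, IsClosed (F i)) (hcov : ∀ x ∈ stdSimplex ℝ ι, ∃ i, x ∈ F i) :
    ∃ x ∈ stdSimplex ℝ ι, ∀ i, 0 < x i → x ∈ F i := by
  set n : ℕ := Fintype.card ι
  have hstep : ∀ N : ℕ, ∃ z ∈ stdSimplex ℝ ι, ∀ i, z i ≤ n / ((N : ℝ) + 1) ∨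
      ∃ y ∈ F i, dist z y ≤ n / ((N : ℝ) + 1) := by
    intro N
    have hN : (0 : ℝ) < (N : ℝ) + 1 := by positivity
    have hmem : ∀ x : ι → ℕ, ∑ j, x j = N + 1 →
        (fun j => (x j : ℝ) / ((N : ℝ) + 1)) ∈ stdSimplex ℝ ι := by
      intro x hx
      refine ⟨fun j => by positivity, ?_⟩
      rw [← Finset.sum_div, ← Nat.cast_sum, hx]
      push_cast
      exact div_self hN.ne'
    have hc : ∀ x : ι → ℕ, ∃ i, ∑ j, x j = N + 1 → (fun j => (x j : ℝ) / ((N : ℝ) + 1)) ∈ F i := by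
      intro x
      by_cases hx : ∑ j, x j = N + 1
      · obtain ⟨i, hi⟩ := hcov _ (hmem x hx)
        exact ⟨i, fun _ => hi⟩
      · exact ⟨Classical.arbitrary ι, fun h => absurd h hx⟩
    choose c hc using hc
    obtain ⟨z, hz, h⟩ := grid (N + 1) c
    refine ⟨_, hmem z hz, fun i => ?_⟩
    rcases h i with h | ⟨y, hy, hyi, hd⟩
    · left
      have : (z i : ℝ) ≤ n := by exact_mod_cast h
      gcongr
    · right
      refine ⟨_, hyi ▸ hc y hy, ?_⟩
      rw [dist_pi_le_iff (by positivity)]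
      intro j
      obtain ⟨h1, h2⟩ := hd j
      have h1' : (z j : ℝ) ≤ y j + n := by exact_mod_cast h1
      have h2' : (y j : ℝ) ≤ z j + n := by exact_mod_cast h2
      rw [Real.dist_eq, ← sub_div, abs_div, abs_of_pos hN]
      gcongr
      rw [abs_le]
      constructor <;> linarith
  choose z hz hprop using hstep
  obtain ⟨x, hx, φ, hφ, hlim⟩ := (isCompact_stdSimplex ℝ ι).tendsto_subseq hz
  refine ⟨x, hx, fun i hi => ?_⟩
  have hδ : Filter.Tendsto (fun N : ℕ => (n : ℝ) / ((N : ℝ) + 1)) Filter.atTop (nhds 0) :=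
    tendsto_const_div_atTop_nhds_zero_nat (n : ℝ) |>.comp (Filter.tendsto_add_atTop_nat 1) |>.congr
      (fun N => by simp)
  have hδ' := hδ.comp hφ.tendsto_atTop
  rw [← (hF i).closure_eq, Metric.mem_closure_iff]
  intro ε hε
  have e1 : ∀ᶠ N in Filter.atTop, (n : ℝ) / ((φ N : ℝ) + 1) < x i / 2 :=
    hδ'.eventually (gt_mem_nhds (by linarith))
  have e2 : ∀ᶠ N in Filter.atTop, x i / 2 < z (φ N) i :=
    ((continuous_apply i).continuousAt.tendsto.comp hlim).eventually (lt_mem_nhds (by linarith))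
  have e3 : ∀ᶠ N in Filter.atTop, (n : ℝ) / ((φ N : ℝ) + 1) < ε / 2 :=
    hδ'.eventually (gt_mem_nhds (by linarith))
  have e4 : ∀ᶠ N in Filter.atTop, dist (z (φ N)) x < ε / 2 :=
    hlim.eventually (Metric.ball_mem_nhds x (by linarith))
  obtain ⟨N, h1, h2, h3, h4⟩ := (e1.and (e2.and (e3.and e4))).exists
  rcases hprop (φ N) i with h | ⟨y, hy, hd⟩
  · linarith
  · refine ⟨y, hy, ?_⟩
    have := dist_triangle x (z (φ N)) y
    rw [dist_comm] at h4
    linarith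

/-! ### The game -/

/-- The set of profiles of distributions. -/
def Prof (S : Fin k → Type*) [∀ j, Fintype (S j)] : Set (∀ j, S j → ℝ) :=
  Set.univ.pi (fun j => stdSimplex ℝ (S j))

theorem mem_Prof {p : ∀ j, S j → ℝ} : p ∈ Prof S ↔ ∀ j, IsDist (p j) := by
  simp only [Prof, Set.mem_univ_pi]
  rfl

/-- The marginals of a weight function. -/
noncomputable def marg (w : (∀ j, S j) → ℝ) : ∀ j, S j → ℝ := fun j s =>
  ∑ e ∈ Finset.univ.filter (fun e : ∀ j, S j => e j = s), w e

theorem continuous_marg : Continuous (marg (S := S)) := by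
  unfold marg
  fun_prop

theorem marg_sum {ι : Type*} (t : Finset ι) (a : ι → ℝ) (w : ι → (∀ j, S j) → ℝ) :
    marg (∑ l ∈ t, a l • w l) = ∑ l ∈ t, a l • marg (w l) := by
  funext j s
  simp only [marg, Finset.sum_apply, Pi.smul_apply, smul_eq_mul, Finset.mul_sum]
  exact Finset.sum_comm

theorem sum_eq_one (i : Fin k) {p : ∀ j, S j → ℝ} (hp : p ∈ Prof S) {w : (∀ j, S j) → ℝ}
    (hw : marg w = p) : ∑ e, w e = 1 := by
  rw [← (mem_Prof.1 hp i).2, ← hw]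
  exact (Finset.sum_fiberwise Finset.univ (fun e : ∀ j, S j => e i) w).symm

theorem exists_marg {p : ∀ j, S j → ℝ} (hp : p ∈ Prof S) :
    ∃ w : (∀ j, S j) → ℝ, (∀ e, 0 ≤ w e) ∧ marg w = p := by
  have hp' := mem_Prof.1 hp
  refine ⟨fun e => ∏ j, p j (e j), fun e => Finset.prod_nonneg fun j _ => (hp' j).1 _, ?_⟩
  funext i s
  have h1 : Finset.univ.filter (fun e : ∀ j, S j => e i = s) =
      Fintype.piFinset (Function.update (fun j => (Finset.univ : Finset (S j))) i {s}) := by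
    ext e
    simp only [Finset.mem_filter, Finset.mem_univ, true_and, Fintype.mem_piFinset]
    constructor
    · intro h j
      by_cases hj : j = i
      · subst hj; simp [h]
      · simp [hj]
    · intro h
      simpa using h i
  simp only [marg]
  rw [h1, ← Finset.prod_univ_sum, ← Finset.mul_prod_erase _ _ (Finset.mem_univ i)]
  rw [Finset.prod_eq_one]
  · simp
  · intro j hj
    rw [Function.update_of_ne (Finset.ne_of_mem_erase hj)]
    exact (hp' j).2

theorem payoff_spec (i : Fin k) (u : (∀ j, S j) → ℝ) {p : ∀ j, S j → ℝ} (hp : p ∈ Prof S) :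
    (∃ w ∈ stdSimplex ℝ (∀ j, S j), marg w = p ∧ ∑ e, w e * u e = ppayoff u p) ∧
    ∀ w : (∀ j, S j) → ℝ, (∀ e, 0 ≤ w e) → marg w = p → ∑ e, w e * u e ≤ ppayoff u p := by
  set W : Set ((∀ j, S j) → ℝ) := stdSimplex ℝ (∀ j, S j) ∩ marg ⁻¹' {p} with hW
  have hWc : IsCompact W :=
    (isCompact_stdSimplex ℝ _).inter_right (isClosed_singleton.preimage continuous_marg)
  have himg : {v : ℝ | ∃ w : (∀ j, S j) → ℝ, (∀ e, 0 ≤ w e) ∧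
      (∀ (j : Fin k) (s : S j),
        ∑ e ∈ Finset.univ.filter (fun e : ∀ j, S j => e j = s), w e = p j s) ∧
      v = ∑ e, w e * u e} = (fun w => ∑ e, w e * u e) '' W := by
    ext v
    constructor
    · rintro ⟨w, h0, hm, rfl⟩
      have hm' : marg w = p := by funext j s; exact hm j s
      exact ⟨w, ⟨⟨h0, sum_eq_one i hp hm'⟩, hm'⟩, rfl⟩
    · rintro ⟨w, ⟨h0, hm⟩, rfl⟩
      exact ⟨w, h0.1, fun j s => congrFun (congrFun hm j) s, rfl⟩
  have hc : IsCompact ((fun w : (∀ j, S j) → ℝ => ∑ e, w e * u e) '' W) :=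
    hWc.image (by fun_prop)
  have hne : ((fun w : (∀ j, S j) → ℝ => ∑ e, w e * u e) '' W).Nonempty := by
    obtain ⟨w, h0, hm⟩ := exists_marg hp
    exact ⟨_, w, ⟨⟨h0, sum_eq_one i hp hm⟩, hm⟩, rfl⟩
  constructor
  · obtain ⟨w, hw, h⟩ := hc.sSup_mem hne
    refine ⟨w, hw.1, hw.2, ?_⟩
    rw [ppayoff, himg]
    exact h
  · intro w h0 hm
    rw [ppayoff, himg]
    exact le_csSup hc.bddAbove ⟨w, ⟨⟨h0, sum_eq_one i hp hm⟩, hm⟩, rfl⟩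

theorem convex_Prof : Convex ℝ (Prof S) := convex_pi fun j _ => convex_stdSimplex ℝ (S j)

theorem compact_Prof : IsCompact (Prof S) :=
  isCompact_univ_pi fun j => isCompact_stdSimplex ℝ (S j)

theorem payoff_concave (i : Fin k) (u : (∀ j, S j) → ℝ) : ConcaveOn ℝ (Prof S) (ppayoff u) := by
  refine ⟨convex_Prof, fun p hp q hq a b ha hb hab => ?_⟩
  obtain ⟨⟨w, hw, hwm, hwv⟩, -⟩ := payoff_spec i u hp
  obtain ⟨⟨w', hw', hwm', hwv'⟩, -⟩ := payoff_spec i u hq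
  have h := (payoff_spec i u (convex_Prof hp hq ha hb hab)).2 (a • w + b • w')
    (fun e => add_nonneg (mul_nonneg ha (hw.1 e)) (mul_nonneg hb (hw'.1 e))) (by
      have := marg_sum Finset.univ ![a, b] ![w, w']
      simpa [Fin.sum_univ_two, hwm, hwm'] using this)
  refine le_trans (le_of_eq ?_) h
  rw [← hwv, ← hwv', smul_eq_mul, smul_eq_mul, Finset.mul_sum, Finset.mul_sum,
    ← Finset.sum_add_distrib]
  refine Finset.sum_congr rfl fun e _ => ?_
  simp only [Pi.add_apply, Pi.smul_apply, smul_eq_mul]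
  ring

theorem payoff_lower (i : Fin k) (u : (∀ j, S j) → ℝ) {p : ∀ j, S j → ℝ} (hp : p ∈ Prof S) :
    -(∑ e, |u e|) ≤ ppayoff u p := by
  obtain ⟨⟨w, hw, hwm, hwv⟩, -⟩ := payoff_spec i u hp
  rw [← hwv, ← Finset.sum_neg_distrib]
  refine Finset.sum_le_sum fun e _ => ?_
  have h0 := hw.1 e
  have h1 : w e ≤ 1 := by
    rw [← hw.2]; exact Finset.single_le_sum (fun e _ => hw.1 e) (Finset.mem_univ e)
  have h2 := neg_abs_le (u e)
  have h3 := abs_nonneg (u e)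
  nlinarith

theorem payoff_continuousOn (i : Fin k) (u : (∀ j, S j) → ℝ) :
    ContinuousOn (ppayoff u) (Prof S) := by
  intro p hp
  rw [ContinuousWithinAt, tendsto_order]
  constructor
  · intro a ha
    set M := ∑ e, |u e|
    obtain ⟨t, ht, ht0, ht1⟩ : ∃ t : ℝ, a < t * ppayoff u p + (1 - t) * (-M) ∧ 0 < t ∧ t < 1 := by
      have hl : Filter.Tendsto (fun t : ℝ => t * ppayoff u p + (1 - t) * (-M)) (nhds 1)
          (nhds (ppayoff u p)) := by
        have : Continuous (fun t : ℝ => t * ppayoff u p + (1 - t) * (-M)) := by fun_prop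
        simpa using this.tendsto 1
      have h1 := (hl.mono_left (nhdsWithin_le_nhds (s := Set.Iio 1))).eventually (lt_mem_nhds ha)
      have h2 : ∀ᶠ t : ℝ in nhdsWithin 1 (Set.Iio 1), t ∈ Set.Ioo (0 : ℝ) 1 :=
        Ioo_mem_nhdsLT one_pos
      obtain ⟨t, h1, h2⟩ := (h1.and h2).exists
      exact ⟨t, h1, h2.1, h2.2⟩
    have hev : ∀ᶠ p' in nhdsWithin p (Prof S), ∀ j, ∀ s, t * p j s ≤ p' j s := by
      rw [Filter.eventually_all]; intro j
      rw [Filter.eventually_all]; intro s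
      rcases ((mem_Prof.1 hp j).1 s).eq_or_lt with h | h
      · filter_upwards [self_mem_nhdsWithin] with p' hp'
        rw [← h, mul_zero]
        exact (mem_Prof.1 hp' j).1 s
      · have hc : Continuous (fun p' : ∀ j, S j → ℝ => p' j s) := by fun_prop
        have := (hc.tendsto p).eventually (lt_mem_nhds (show t * p j s < p j s by nlinarith))
        exact (this.filter_mono nhdsWithin_le_nhds).mono fun p' h => le_of_lt h
    filter_upwards [hev, self_mem_nhdsWithin] with p' hle hp'
    have h1t : 0 < 1 - t := by linarith
    set q : ∀ j, S j → ℝ := (1 - t)⁻¹ • (p' - t • p) with hq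
    have hqP : q ∈ Prof S := by
      rw [mem_Prof]
      intro j
      refine ⟨fun s => mul_nonneg (by positivity) ?_, ?_⟩
      · have := hle j s
        simp only [Pi.sub_apply, Pi.smul_apply, smul_eq_mul]
        linarith
      · simp only [hq, Pi.sub_apply, Pi.smul_apply, smul_eq_mul]
        rw [← Finset.mul_sum, Finset.sum_sub_distrib, ← Finset.mul_sum, (mem_Prof.1 hp j).2,
          (mem_Prof.1 hp' j).2, mul_one, inv_mul_cancel₀ h1t.ne']
    have hcomb : t • p + (1 - t) • q = p' := by
      rw [hq, smul_smul, mul_inv_cancel₀ h1t.ne', one_smul]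
      abel
    have := (payoff_concave i u).2 hp hqP ht0.le h1t.le (by ring)
    rw [hcomb, smul_eq_mul, smul_eq_mul] at this
    have h3 := payoff_lower i u hqP
    nlinarith
  · intro a ha
    set K : Set ((∀ j, S j) → ℝ) := stdSimplex ℝ (∀ j, S j) ∩ {w | a ≤ ∑ e, w e * u e}
    have hK : IsCompact K := (isCompact_stdSimplex ℝ _).inter_right
      (isClosed_le continuous_const (by fun_prop))
    have hcl : IsClosed (marg '' K) := (hK.image continuous_marg).isClosed
    have hpn : p ∉ marg '' K := by
      rintro ⟨w, ⟨hw, hwa⟩, hm⟩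
      have := (payoff_spec i u hp).2 w hw.1 hm
      simp only [Set.mem_ofPred_eq] at hwa
      linarith
    have hev : ∀ᶠ p' in nhdsWithin p (Prof S), p' ∉ marg '' K :=
      (hcl.isOpen_compl.mem_nhds hpn : _) |> fun h => mem_nhdsWithin_of_mem_nhds h
    filter_upwards [hev, self_mem_nhdsWithin] with p' hn hp'
    by_contra hcon
    push Not at hcon
    obtain ⟨⟨w, hw, hwm, hwv⟩, -⟩ := payoff_spec i u hp'
    exact hn ⟨w, ⟨hw, by rw [Set.mem_ofPred_eq, hwv]; exact hcon⟩, hwm⟩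

theorem update_mem {p : ∀ j, S j → ℝ} (hp : p ∈ Prof S) (i : Fin k) {q : S i → ℝ}
    (hq : IsDist q) : Function.update p i q ∈ Prof S := by
  rw [mem_Prof] at hp ⊢
  intro j
  by_cases hj : j = i
  · subst hj; simpa using hq
  · simpa [hj] using hp j

/-- The Nikaido-Isoda function. -/
noncomputable def nik (u : ∀ _ : Fin k, (∀ j, S j) → ℝ) (p q : ∀ j, S j → ℝ) : ℝ :=
  ∑ i, (ppayoff (u i) (Function.update p i (q i)) - ppayoff (u i) p)

theorem nik_continuousOn (u : ∀ _ : Fin k, (∀ j, S j) → ℝ) {q : ∀ j, S j → ℝ} (hq : q ∈ Prof S) :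
    ContinuousOn (fun p => nik u p q) (Prof S) := by
  unfold nik
  refine continuousOn_finsetSum _ fun i _ => ContinuousOn.sub ?_ (payoff_continuousOn i (u i))
  refine (payoff_continuousOn i (u i)).comp (f := fun p => Function.update p i (q i)) ?_
    fun p hp => update_mem hp i (mem_Prof.1 hq i)
  exact (continuous_id.update i continuous_const).continuousOn

theorem nik_concave (u : ∀ _ : Fin k, (∀ j, S j) → ℝ) {ι : Type*} [Fintype ι]
    (a : ι → ℝ) (ha : a ∈ stdSimplex ℝ ι) (q : ι → ∀ j, S j → ℝ) (hq : ∀ l, q l ∈ Prof S) :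
    ∑ l, a l * nik u (∑ l, a l • q l) (q l) ≤ 0 := by
  set p := ∑ l, a l • q l with hpdef
  have hp : p ∈ Prof S := convex_Prof.sum_mem (fun l _ => ha.1 l) ha.2 fun l _ => hq l
  have h : ∀ i, ∑ l, a l * (ppayoff (u i) (Function.update p i (q l i)) - ppayoff (u i) p) ≤ 0 := by
    intro i
    have h1 := (payoff_concave i (u i)).le_map_sum (t := Finset.univ) (w := a)
      (p := fun l => Function.update p i (q l i)) (fun l _ => ha.1 l) ha.2
      (fun l _ => update_mem hp i (mem_Prof.1 (hq l) i))
    have h2 : ∑ l, a l • Function.update p i (q l i) = p := by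
      funext j
      by_cases hj : j = i
      · subst hj
        simp [hpdef, Finset.sum_apply]
      · simp only [Finset.sum_apply, Pi.smul_apply, Function.update_of_ne hj]
        rw [← Finset.sum_smul, ha.2, one_smul]
    rw [h2] at h1
    simp only [mul_sub, Finset.sum_sub_distrib, ← Finset.sum_mul, ha.2, one_mul]
    simp only [smul_eq_mul] at h1
    linarith
  unfold nik
  simp only [Finset.mul_sum]
  rw [Finset.sum_comm]
  exact Finset.sum_nonpos fun i _ => h i

theorem exists_eq [∀ j, Nonempty (S j)] (u : ∀ _ : Fin k, (∀ j, S j) → ℝ) :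
    ∃ p : ∀ j, S j → ℝ, PersonalizedEq u p := by
  by_contra hcon
  push Not at hcon
  have hdev : ∀ p ∈ Prof S, ∃ q ∈ Prof S, 0 < nik u p q := by
    intro p hp
    have h := hcon p
    unfold PersonalizedEq at h
    push Not at h
    obtain ⟨i, q, hq, hlt⟩ := h (mem_Prof.1 hp)
    refine ⟨Function.update p i q, update_mem hp i hq, ?_⟩
    unfold nik
    rw [Finset.sum_eq_single i]
    · rw [Function.update_self]; linarith
    · intro j _ hj
      rw [Function.update_of_ne hj, Function.update_eq_self, sub_self]
    · simp
  choose! q hqP hq using hdev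
  obtain ⟨t, htP, hcov⟩ := compact_Prof.elim_nhdsWithin_subcover
    (fun p => {p' | 0 < nik u p' (q p)}) (fun p hp =>
      (nik_continuousOn u (hqP p hp) p hp).eventually (lt_mem_nhds (hq p hp)))
  have hne : Nonempty t := by
    have : (fun j => Pi.single (Classical.arbitrary (S j)) 1 : ∀ j, S j → ℝ) ∈ Prof S := by
      simp only [Prof, Set.mem_univ_pi]
      exact fun j => single_mem_stdSimplex ℝ _
    obtain ⟨l, hl, -⟩ := Set.mem_iUnion₂.1 (hcov this)
    exact ⟨⟨l, hl⟩⟩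
  have hQ : ∀ l : t, q l.1 ∈ Prof S := fun l => hqP _ (htP _ l.2)
  set P : (t → ℝ) → ∀ j, S j → ℝ := fun a => ∑ l, a l • q l.1 with hP
  have hPm : ∀ a ∈ stdSimplex ℝ t, P a ∈ Prof S := fun a ha =>
    convex_Prof.sum_mem (fun l _ => ha.1 l) ha.2 fun l _ => hQ l
  have hPc : Continuous P := by rw [hP]; fun_prop
  have hcont : ∀ l : t, ContinuousOn (fun a => nik u (P a) (q l.1)) (stdSimplex ℝ t) := fun l =>
    (nik_continuousOn u (hQ l)).comp hPc.continuousOn hPm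
  obtain ⟨a, ha, hmax⟩ := kkm
    (fun l : t => ⋂ l' : t, {a ∈ stdSimplex ℝ t | nik u (P a) (q l'.1) ≤ nik u (P a) (q l.1)})
    (fun l => isClosed_iInter fun l' =>
      (isClosed_stdSimplex ℝ t).isClosed_le (hcont l') (hcont l))
    (fun a ha => by
      obtain ⟨l, -, hl⟩ := Finset.univ.exists_max_image (fun l : t => nik u (P a) (q l.1))
        Finset.univ_nonempty
      exact ⟨l, Set.mem_iInter.2 fun l' => ⟨ha, hl l' (Finset.mem_univ _)⟩⟩)
  obtain ⟨l₀, hl₀, hpos⟩ := Set.mem_iUnion₂.1 (hcov (hPm a ha))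
  have hpos' : ∀ l, 0 < a l → 0 < nik u (P a) (q l.1) := fun l hl =>
    lt_of_lt_of_le hpos (Set.mem_iInter.1 (hmax l hl) ⟨l₀, hl₀⟩).2
  have hle := nik_concave u a ha (fun l : t => q l.1) hQ
  obtain ⟨l, -, hl⟩ : ∃ l ∈ (Finset.univ : Finset t), 0 < a l := by
    apply Finset.exists_lt_of_sum_lt (f := fun _ : t => (0 : ℝ))
    rw [ha.2]; simp
  have : 0 < ∑ l, a l * nik u (P a) (q l.1) := by
    refine Finset.sum_pos' (fun l _ => ?_) ⟨l, Finset.mem_univ _, mul_pos hl (hpos' l hl)⟩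
    rcases (ha.1 l).eq_or_lt with h | h
    · rw [← h, zero_mul]
    · exact (mul_pos h (hpos' l h)).le
  exact absurd hle (not_le.2 this)

end PersEq

/-- Every finite multi-player matrix game has a personalized equilibrium. -/
theorem personalized_equilibrium_exists [∀ j, Nonempty (S j)]
    (u : ∀ _ : Fin k, (∀ j, S j) → ℝ) :
    ∃ p : ∀ j, S j → ℝ, PersonalizedEq u p := by
  exact PersEq.exists_eq u
end

section
/- For any k-player matrix game with all rational utilities, there exists a personalized equilibrium in which every probability p_i(s) is a rational number. -/
attribute [local instance] Classical.propDecidable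

variable {k : ℕ} {S : Fin k → Type*} [∀ j, Fintype (S j)]

/-! ### A combinatorial lemma of Scarf type -/

/-- `B` is dominant for the family of rankings `r`. -/
def SDom {Y I : Type} (r : I → Y → ℕ) (B : Finset Y) : Prop :=
  ∀ y, ∃ i, ∀ x ∈ B, r i y ≤ r i x

theorem scarf_exists_room {Y I : Type} [Fintype Y] (r : I → Y → ℕ)
    (hinj : ∀ i, Function.Injective (r i)) (B : Finset Y) (hB : SDom r B)
    (m : I → Y) (hm : ∀ i, m i ∈ B) (hmin : ∀ i, ∀ x ∈ B, r i (m i) ≤ r i x)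
    (d : I) (hsurj : ∀ x ∈ B, ∃ a, a ≠ d ∧ m a = x)
    (hne : ∃ y, ∀ a, a ≠ d → r a (m a) < r a y) :
    ∃ x, x ∉ B ∧ SDom r (insert x B) ∧ (∀ a, a ≠ d → r a (m a) < r a x) ∧
      ∀ x', (∀ a, a ≠ d → r a (m a) < r a x') → SDom r (insert x' B) → x' = x := by
  obtain ⟨y0, hy0⟩ := hne
  obtain ⟨x, hxM, hxmax⟩ := Finset.exists_max_image
    (Finset.univ.filter (fun y => ∀ a, a ≠ d → r a (m a) < r a y)) (r d) ⟨y0, by simpa using hy0⟩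
  simp only [Finset.mem_filter, Finset.mem_univ, true_and] at hxM hxmax
  have hxd : ∀ z ∈ B, r d x ≤ r d z := by
    obtain ⟨a, ha⟩ := hB x
    by_cases had : a = d
    · subst had; exact ha
    · exact absurd (ha _ (hm a)) (not_le.2 (hxM a had))
  refine ⟨x, ?_, ?_, hxM, ?_⟩
  · intro hx
    obtain ⟨a, had, hma⟩ := hsurj x hx
    have := hxM a had
    rw [hma] at this
    exact lt_irrefl _ this
  · intro y
    by_cases hy : ∀ a, a ≠ d → r a (m a) < r a y
    · refine ⟨d, fun z hz => ?_⟩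
      have h1 := hxmax y hy
      rcases Finset.mem_insert.1 hz with rfl | hz
      · exact h1
      · exact h1.trans (hxd z hz)
    · push Not at hy
      obtain ⟨a, had, hya⟩ := hy
      refine ⟨a, fun z hz => ?_⟩
      rcases Finset.mem_insert.1 hz with rfl | hz
      · exact hya.trans (hxM a had).le
      · exact hya.trans (hmin a z hz)
  · intro x' hx' hdom
    have h1 := hxmax x' hx'
    obtain ⟨a, ha⟩ := hdom x
    have had : a = d := by
      by_contra had
      exact absurd (ha _ (Finset.mem_insert_of_mem (hm a))) (not_le.2 (hxM a had))
    subst had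
    exact hinj _ (le_antisymm h1 (ha _ (Finset.mem_insert_self _ _)))

theorem scarf_door_two {Y I : Type} [Fintype Y] [Fintype I] (r : I → Y → ℕ)
    (hinj : ∀ i, Function.Injective (r i)) (s : I → Y)
    (hs0 : ∀ i y, y ≠ s i → r i (s i) < r i y)
    (hs1 : ∀ i j x, i ≠ j → x ∉ Set.range s → r i x < r i (s j))
    (B : Finset Y) (hB : SDom r B) (hcard : B.card + 1 = Fintype.card I)
    (x0 : Y) (hx0 : x0 ∈ B) (hx0s : x0 ∉ Set.range s) :
    (Finset.univ.filter (fun y => y ∉ B ∧ SDom r (insert y B))).card = 2 := by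
  have h1 : ∀ i, ∃ x ∈ B, ∀ z ∈ B, r i x ≤ r i z := fun i =>
    Finset.exists_min_image B (r i) ⟨x0, hx0⟩
  choose m hm hmin using h1
  have hsurj : ∀ x ∈ B, ∃ a, m a = x := by
    intro x hx
    obtain ⟨a, ha⟩ := hB x
    exact ⟨a, hinj a (le_antisymm (hmin a x hx) (ha _ (hm a)))⟩
  obtain ⟨i, -, j, -, hij, hmij⟩ := Finset.exists_ne_map_eq_of_card_lt_of_maps_to
    (s := (Finset.univ : Finset I)) (t := B) (f := m)
    (by rw [Finset.card_univ]; omega) (fun a _ => hm a)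
  -- nonemptiness
  have hslack : ∀ d e, d ≠ e → m d = m e → ∀ a, a ≠ d → r a (m a) < r a (s d) := by
    intro d e hde hmde a had
    have hle : r a (m a) ≤ r a x0 := hmin a x0 hx0
    exact hle.trans_lt (hs1 a d x0 had hx0s)
  have hsi : ∀ x ∈ B, ∃ a, a ≠ i ∧ m a = x := by
    intro x hx
    obtain ⟨a, ha⟩ := hsurj x hx
    by_cases h : a = i
    · exact ⟨j, hij.symm, by rw [← hmij, ← h, ha]⟩
    · exact ⟨a, h, ha⟩
  have hsj : ∀ x ∈ B, ∃ a, a ≠ j ∧ m a = x := by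
    intro x hx
    obtain ⟨a, ha⟩ := hsurj x hx
    by_cases h : a = j
    · exact ⟨i, hij, by rw [hmij, ← h, ha]⟩
    · exact ⟨a, h, ha⟩
  obtain ⟨xi, hxi1, hxi2, hxi3, hxi4⟩ := scarf_exists_room r hinj B hB m hm hmin i hsi
    ⟨s i, hslack i j hij hmij⟩
  obtain ⟨xj, hxj1, hxj2, hxj3, hxj4⟩ := scarf_exists_room r hinj B hB m hm hmin j hsj
    ⟨s j, hslack j i hij.symm hmij.symm⟩
  have key : ∀ x', x' ∉ B → SDom r (insert x' B) →
      ∃ d, (d = i ∨ d = j) ∧ ∀ a, a ≠ d → r a (m a) < r a x' := by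
    intro x' hx' hdom
    choose g hg using hdom
    have hgi : Set.InjOn g (insert x' B : Finset Y) := by
      intro p hp q hq hpq
      have h1 := hg p q hq
      have h2 := hg q p hp
      rw [← hpq] at h2
      exact hinj _ (le_antisymm h1 h2)
    have hgs : ∀ a, ∃ x ∈ insert x' B, g x = a := by
      have : (insert x' B).image g = Finset.univ := by
        apply Finset.eq_univ_of_card
        rw [Finset.card_image_of_injOn hgi, Finset.card_insert_of_notMem hx', hcard]
      intro a
      have ha : a ∈ (insert x' B).image g := by rw [this]; exact Finset.mem_univ _
      exact Finset.mem_image.1 ha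
    have hmg : ∀ a, a ≠ g x' → g (m a) = a ∧ m a ≠ x' := by
      intro a ha
      obtain ⟨x, hx, hxa⟩ := hgs a
      rcases Finset.mem_insert.1 hx with rfl | hxB
      · exact absurd hxa.symm ha
      · have : m a = x := by
          apply hinj a
          apply le_antisymm (hmin a x hxB)
          have := hg x (m a) (Finset.mem_insert_of_mem (hm a))
          rwa [hxa] at this
        rw [this]
        exact ⟨hxa, fun h => hx' (h ▸ hxB)⟩
    refine ⟨g x', ?_, ?_⟩
    · by_contra hcon
      push Not at hcon
      have h1 := (hmg i hcon.1.symm).1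
      have h2 := (hmg j hcon.2.symm).1
      rw [hmij] at h1
      exact hij (h1.symm.trans h2)
    · intro a ha
      obtain ⟨h1, h2⟩ := hmg a ha
      have h3 := hg (m a) x' (Finset.mem_insert_self _ _)
      rw [h1] at h3
      exact lt_of_le_of_ne h3 (fun h => h2 (hinj a h))
  have hne : xi ≠ xj := by
    intro h
    have h1 := hxi3 j hij.symm
    rw [h] at h1
    obtain ⟨a, ha⟩ := hB xj
    by_cases haj : a = j
    · subst haj
      exact absurd (ha _ (hm a)) (not_le.2 h1)
    · exact absurd (ha _ (hm a)) (not_le.2 (hxj3 a haj))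
  rw [Finset.card_eq_two]
  refine ⟨xi, xj, hne, ?_⟩
  ext y
  simp only [Finset.mem_filter, Finset.mem_univ, true_and, Finset.mem_insert,
    Finset.mem_singleton]
  constructor
  · rintro ⟨h1, h2⟩
    obtain ⟨d, rfl | rfl, hd⟩ := key y h1 h2
    · exact Or.inl (hxi4 y hd h2)
    · exact Or.inr (hxj4 y hd h2)
  · rintro (rfl | rfl)
    · exact ⟨hxi1, hxi2⟩
    · exact ⟨hxj1, hxj2⟩

theorem scarf_door_one {Y I : Type} [Fintype Y] [Fintype I] (r : I → Y → ℕ)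
    (hinj : ∀ i, Function.Injective (r i)) (s : I → Y)
    (hs0 : ∀ i y, y ≠ s i → r i (s i) < r i y)
    (hs1 : ∀ i j x, i ≠ j → x ∉ Set.range s → r i x < r i (s j))
    (hY : ∃ x, x ∉ Set.range s) (i0 : I) (B : Finset Y)
    (hBs : ∀ y, y ∈ B ↔ ∃ j, j ≠ i0 ∧ s j = y) :
    (Finset.univ.filter (fun y => y ∉ B ∧ SDom r (insert y B))).card = 1 := by
  obtain ⟨w, hw⟩ := hY
  obtain ⟨x, hxM, hxmax⟩ := Finset.exists_max_image
    (Finset.univ.filter (fun y => y ∉ Set.range s)) (r i0) ⟨w, by simpa using hw⟩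
  simp only [Finset.mem_filter, Finset.mem_univ, true_and] at hxM hxmax
  have hxB : x ∉ B := by
    rw [hBs]; rintro ⟨j, -, h⟩; exact hxM ⟨j, h⟩
  have hs0' : ∀ i y, r i (s i) ≤ r i y := by
    intro i y
    by_cases h : y = s i
    · rw [h]
    · exact (hs0 i y h).le
  rw [Finset.card_eq_one]
  refine ⟨x, ?_⟩
  ext y
  simp only [Finset.mem_filter, Finset.mem_univ, true_and, Finset.mem_singleton]
  constructor
  · rintro ⟨hyB, hdom⟩
    have hno : ∀ z, z ∉ Set.range s → ∀ i, (∀ x ∈ insert y B, r i z ≤ r i x) → i = i0 := by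
      intro z hz i hi
      by_contra hne
      have h1 := hi (s i) (Finset.mem_insert_of_mem ((hBs _).2 ⟨i, hne, rfl⟩))
      have h2 := hs0 i z (fun h => hz ⟨i, h.symm⟩)
      omega
    obtain ⟨a, ha⟩ := hdom x
    have := hno x hxM a ha
    subst this
    have h1 := ha y (Finset.mem_insert_self _ _)
    have hy : y ∉ Set.range s := by
      rintro ⟨j, rfl⟩
      by_cases hj : j = a
      · subst hj
        have := hs0 j x (fun h => hxM ⟨j, h.symm⟩)
        omega
      · exact hyB ((hBs _).2 ⟨j, hj, rfl⟩)
    exact hinj a (le_antisymm (hxmax y hy) h1)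
  · rintro rfl
    refine ⟨hxB, fun z => ?_⟩
    by_cases hz : z ∈ Set.range s
    · obtain ⟨j, rfl⟩ := hz
      exact ⟨j, fun t _ => hs0' j t⟩
    · refine ⟨i0, fun t ht => ?_⟩
      rcases Finset.mem_insert.1 ht with rfl | ht
      · exact hxmax z hz
      · obtain ⟨j, hj, rfl⟩ := (hBs t).1 ht
        exact (hs1 i0 j z hj.symm hz).le

theorem scarf_even {Y I : Type} [Fintype Y] [Fintype I] (c : Y → I) (i0 : I)
    (B : Finset Y) (hcard : B.card = Fintype.card I) (hnc : ∃ i, ∀ x ∈ B, c x ≠ i) :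
    Even (B.filter (fun y => (B.erase y).image c = Finset.univ.erase i0)).card := by
  rcases Finset.eq_empty_or_nonempty
    (B.filter (fun y => (B.erase y).image c = Finset.univ.erase i0)) with h | ⟨y0, hy0⟩
  · rw [h]; simp
  obtain ⟨hy0B, hy0⟩ := Finset.mem_filter.1 hy0
  have hcol : ∀ i, i ≠ i0 → ∃ x ∈ B, x ≠ y0 ∧ c x = i := by
    intro i hi
    have : i ∈ (B.erase y0).image c := by rw [hy0]; simp [hi]
    obtain ⟨x, hx, hxi⟩ := Finset.mem_image.1 this
    exact ⟨x, Finset.mem_of_mem_erase hx, Finset.ne_of_mem_erase hx, hxi⟩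
  have hcol' : ∀ x ∈ B, x ≠ y0 → c x ≠ i0 := by
    intro x hx hxy
    have : c x ∈ (B.erase y0).image c :=
      Finset.mem_image_of_mem _ (Finset.mem_erase.2 ⟨hxy, hx⟩)
    rw [hy0] at this
    exact Finset.ne_of_mem_erase this
  have hc0 : c y0 ≠ i0 := by
    intro h
    obtain ⟨i, hi⟩ := hnc
    by_cases hii : i = i0
    · exact hi y0 hy0B (h.trans hii.symm)
    · obtain ⟨x, hx, -, hxi⟩ := hcol i hii
      exact hi x hx hxi
  obtain ⟨y1, hy1B, hy1ne, hy1c⟩ := hcol (c y0) hc0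
  have hinj : Set.InjOn c (B.erase y0 : Finset Y) := by
    rw [← Finset.card_image_iff, hy0, Finset.card_erase_of_mem (Finset.mem_univ _),
      Finset.card_erase_of_mem hy0B, hcard, Finset.card_univ]
  have hinj' : ∀ x ∈ B, x ≠ y0 → ∀ y ∈ B, y ≠ y0 → c x = c y → x = y := by
    intro x hx hx0 y hy hyy0 h
    exact hinj (Finset.mem_coe.2 (Finset.mem_erase.2 ⟨hx0, hx⟩))
      (Finset.mem_coe.2 (Finset.mem_erase.2 ⟨hyy0, hy⟩)) h
  have : B.filter (fun y => (B.erase y).image c = Finset.univ.erase i0) = {y0, y1} := by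
    ext y
    simp only [Finset.mem_filter, Finset.mem_insert, Finset.mem_singleton]
    constructor
    · rintro ⟨hyB, hy⟩
      by_contra hcon
      push Not at hcon
      have h1 : c y ∈ (B.erase y).image c := by
        rw [hy]; simp [hcol' y hyB hcon.1]
      obtain ⟨z, hz, hzy⟩ := Finset.mem_image.1 h1
      have hzB := Finset.mem_of_mem_erase hz
      have hzne := Finset.ne_of_mem_erase hz
      by_cases hz0 : z = y0
      · subst hz0
        exact hcon.2 (hinj' y hyB hcon.1 y1 hy1B hy1ne (hzy.symm.trans hy1c.symm))
      · exact hzne (hinj' z hzB hz0 y hyB hcon.1 hzy)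
    · rintro (rfl | rfl)
      · exact ⟨hy0B, hy0⟩
      · refine ⟨hy1B, ?_⟩
        ext i
        simp only [Finset.mem_image, Finset.mem_erase, Finset.mem_univ, and_true]
        constructor
        · rintro ⟨x, ⟨hx1, hxB⟩, rfl⟩
          by_cases hx0 : x = y0
          · rw [hx0]; exact hc0
          · exact hcol' x hxB hx0
        · intro hi
          obtain ⟨x, hxB, hx0, hxi⟩ := hcol i hi
          by_cases hx1 : x = y
          · exact ⟨y0, ⟨hy1ne.symm, hy0B⟩, by rw [← hxi, hx1, hy1c]⟩
          · exact ⟨x, ⟨hx1, hxB⟩, hxi⟩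
  rw [this, Finset.card_pair hy1ne.symm]
  exact even_two

theorem scarf_lemma {Y I : Type} [Fintype Y] [Fintype I] [Nonempty I] (r : I → Y → ℕ)
    (hinj : ∀ i, Function.Injective (r i)) (s : I → Y) (hsinj : Function.Injective s)
    (hs0 : ∀ i y, y ≠ s i → r i (s i) < r i y)
    (hs1 : ∀ i j x, i ≠ j → x ∉ Set.range s → r i x < r i (s j))
    (hY : ∃ x, x ∉ Set.range s) (c : Y → I) (hc : ∀ i, c (s i) = i) :
    ∃ B : Finset Y, SDom r B ∧ ∀ i, ∃ x ∈ B, c x = i := by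
  by_contra hcon
  push Not at hcon
  obtain ⟨i0⟩ := ‹Nonempty I›
  set P : Finset (Finset Y × Y) := Finset.univ.filter (fun p => p.2 ∈ p.1 ∧ SDom r p.1 ∧
    p.1.card = Fintype.card I ∧ (p.1.erase p.2).image c = Finset.univ.erase i0) with hP
  have hmono : ∀ A B : Finset Y, A ⊆ B → SDom r B → SDom r A := by
    intro A B hAB h y
    obtain ⟨i, hi⟩ := h y
    exact ⟨i, fun x hx => hi x (hAB hx)⟩
  have heven : Even P.card := by
    rw [Finset.card_eq_sum_card_fiberwise (f := Prod.fst) (t := Finset.univ)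
      (fun _ _ => Finset.mem_coe.2 (Finset.mem_univ _))]
    refine Finset.even_sum _ (fun B _ => ?_)
    by_cases hB : SDom r B ∧ B.card = Fintype.card I
    · have := scarf_even c i0 B hB.2 (hcon B hB.1)
      suffices hEq : (B.filter (fun y => (B.erase y).image c = Finset.univ.erase i0)).card =
          (P.filter (fun p => p.1 = B)).card by rwa [hEq] at this
      apply Finset.card_bij (fun y _ => (B, y))
      · intro y hy
        simp only [Finset.mem_filter] at hy
        simp [hP, hB.1, hB.2, hy.1, hy.2]
      · intro y _ y' _ h
        exact (Prod.mk.inj h).2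
      · rintro ⟨B', y⟩ h
        simp only [hP, Finset.mem_filter, Finset.mem_univ, true_and] at h
        obtain ⟨⟨h1, h2, h3, h4⟩, rfl⟩ := h
        exact ⟨y, by simp [h1, h4], rfl⟩
    · have : P.filter (fun p => p.1 = B) = ∅ := by
        ext ⟨B', y⟩
        simp only [hP, Finset.mem_filter, Finset.mem_univ, true_and, Finset.notMem_empty,
          iff_false]
        rintro ⟨⟨h1, h2, h3, h4⟩, rfl⟩
        exact hB ⟨h2, h3⟩
      rw [this]; simp
  set E : Finset Y := (Finset.univ.erase i0).image s with hE
  have hEm : ∀ y, y ∈ E ↔ ∃ j, j ≠ i0 ∧ s j = y := by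
    intro y; simp [hE]
  have hfib : ∀ B : Finset Y, SDom r B → B.card + 1 = Fintype.card I →
      B.image c = Finset.univ.erase i0 →
      (P.filter (fun p => p.1.erase p.2 = B)).card =
        (Finset.univ.filter (fun y => y ∉ B ∧ SDom r (insert y B))).card := by
    intro B hB1 hB2 hB3
    symm
    apply Finset.card_bij (fun y _ => (insert y B, y))
    · intro y hy
      simp only [Finset.mem_filter, Finset.mem_univ, true_and] at hy
      simp [hP, hy.1, hy.2, hB3, hB2]
    · intro y _ y' _ h
      exact (Prod.mk.inj h).2
    · rintro ⟨B', y⟩ h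
      simp only [hP, Finset.mem_filter, Finset.mem_univ, true_and] at h
      obtain ⟨⟨h1, h2, h3, h4⟩, rfl⟩ := h
      exact ⟨y, by simp [Finset.insert_erase h1, h2], by simp [Finset.insert_erase h1]⟩
  have hodd : Odd P.card := by
    rw [Finset.card_eq_sum_card_fiberwise (f := fun p => p.1.erase p.2) (t := Finset.univ)
      (fun _ _ => Finset.mem_coe.2 (Finset.mem_univ _)),
      ← Finset.add_sum_erase _ _ (Finset.mem_univ E)]
    apply Odd.add_even
    · rw [hfib E, scarf_door_one r hinj s hs0 hs1 hY i0 E hEm]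
      · exact odd_one
      · intro y
        by_cases hy : y ∈ Set.range s
        · obtain ⟨j, rfl⟩ := hy
          refine ⟨j, fun x _ => ?_⟩
          by_cases h : x = s j
          · rw [h]
          · exact (hs0 j x h).le
        · refine ⟨i0, fun x hx => ?_⟩
          obtain ⟨j, hj, rfl⟩ := (hEm x).1 hx
          exact (hs1 i0 j y hj.symm hy).le
      · rw [hE, Finset.card_image_of_injective _ hsinj,
          Finset.card_erase_of_mem (Finset.mem_univ _), Finset.card_univ]
        have : 0 < Fintype.card I := Fintype.card_pos_iff.2 ⟨i0⟩
        omega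
      · rw [hE, Finset.image_image]
        have : c ∘ s = id := funext hc
        rw [this, Finset.image_id]
    · refine Finset.even_sum _ (fun B hBE => ?_)
      have hBE' := Finset.ne_of_mem_erase hBE
      rcases Finset.eq_empty_or_nonempty (P.filter (fun p => p.1.erase p.2 = B)) with h | ⟨p, hp⟩
      · rw [h]; simp
      · simp only [hP, Finset.mem_filter, Finset.mem_univ, true_and] at hp
        obtain ⟨⟨h1, h2, h3, h4⟩, h5⟩ := hp
        rw [h5] at h4
        have hB1 : SDom r B := hmono _ _ (h5 ▸ Finset.erase_subset _ _) h2
        have hB2 : B.card + 1 = Fintype.card I := by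
          rw [← h5, Finset.card_erase_add_one h1, h3]
        rw [hfib B hB1 hB2 h4]
        have : ∃ x0 ∈ B, x0 ∉ Set.range s := by
          by_contra hno
          push Not at hno
          apply hBE'
          ext y
          rw [hEm]
          constructor
          · intro hy
            obtain ⟨j, rfl⟩ := hno y hy
            refine ⟨j, ?_, rfl⟩
            have : c (s j) ∈ B.image c := Finset.mem_image_of_mem _ hy
            rw [h4, hc] at this
            exact Finset.ne_of_mem_erase this
          · rintro ⟨j, hj, rfl⟩
            have : j ∈ B.image c := by rw [h4]; simp [hj]
            obtain ⟨x, hx, hxj⟩ := Finset.mem_image.1 this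
            obtain ⟨j', rfl⟩ := hno x hx
            rw [hc] at hxj
            rwa [← hxj]
        obtain ⟨x0, hx0, hx0s⟩ := this
        rw [scarf_door_two r hinj s hs0 hs1 B hB1 hB2 x0 hx0 hx0s]
        exact even_two
  exact (Nat.not_even_iff_odd.2 hodd) heven

/-! ### Brouwer's fixed point theorem on the standard simplex -/

theorem grid_lemma (n N : ℕ) (hn : 0 < n) (c : (Fin n → ℕ) → Fin n) :
    ∃ x0 : Fin n → ℕ, ∑ i, x0 i = N ∧ ∀ i, x0 i < n ∨
      ∃ x : Fin n → ℕ, ∑ i, x i = N ∧ c x = i ∧ ∀ j, x j ≤ x0 j + n ∧ x0 j ≤ x j + n := by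
  let X := {x : Fin n → ℕ // x ∈ Finset.piAntidiag (Finset.univ : Finset (Fin n)) N}
  have hXsum : ∀ x : X, ∑ i, x.1 i = N := fun x => (Finset.mem_piAntidiag.1 x.2).1
  have hXmk : ∀ x : Fin n → ℕ, ∑ i, x i = N →
      x ∈ Finset.piAntidiag (Finset.univ : Finset (Fin n)) N := fun x hx =>
    Finset.mem_piAntidiag.2 ⟨hx, fun i _ => Finset.mem_univ i⟩
  have hXle : ∀ (x : X) i, x.1 i ≤ N := by
    intro x i
    exact (Finset.single_le_sum (f := x.1) (fun _ _ => Nat.zero_le _)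
      (Finset.mem_univ i)).trans (hXsum x).le
  let K := Fintype.card X
  let e : X ≃ Fin K := Fintype.equivFin X
  let rX : Fin n → X → ℕ := fun i x => 1 + x.1 i * K + (e x : ℕ)
  let r : Fin n → X ⊕ Fin n → ℕ := fun i => Sum.elim (rX i)
    (fun j => if i = j then 0 else 1 + (N + 1) * K + (j : ℕ))
  have hrl : ∀ i x, r i (Sum.inl x) = 1 + x.1 i * K + (e x : ℕ) := fun _ _ => rfl
  have hrr : ∀ i j, r i (Sum.inr j) = if i = j then 0 else 1 + (N + 1) * K + (j : ℕ) :=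
    fun _ _ => rfl
  have hbig : ∀ i x, r i (Sum.inl x) < 1 + (N + 1) * K := by
    intro i x
    rw [hrl]
    have h1 := (e x).2
    have h2 : x.1 i * K ≤ N * K := Nat.mul_le_mul_right _ (hXle x i)
    rw [Nat.add_mul]
    omega
  have hmono : ∀ i (x y : X), r i (Sum.inl y) ≤ r i (Sum.inl x) → y.1 i ≤ x.1 i := by
    intro i x y h
    by_contra hlt
    push Not at hlt
    rw [hrl, hrl] at h
    have h1 := (e x).2
    have h2 : (x.1 i + 1) * K ≤ y.1 i * K := Nat.mul_le_mul_right _ hlt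
    rw [Nat.add_mul] at h2
    omega
  have hinj : ∀ i, Function.Injective (r i) := by
    intro i a b h
    rcases a with x | j <;> rcases b with y | j'
    · have h1 := hmono i x y h.ge
      have h2 := hmono i y x h.le
      have h3 : x.1 i = y.1 i := le_antisymm h2 h1
      rw [hrl, hrl, h3] at h
      have : e x = e y := Fin.ext (by omega)
      rw [e.injective this]
    · exfalso
      have h1 := hbig i x
      have h2 := hrl i x
      rw [h, hrr] at h1
      rw [h, hrr] at h2
      split_ifs at h1 h2 <;> omega
    · exfalso
      have h1 := hbig i y
      have h2 := hrl i y
      rw [← h, hrr] at h1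
      rw [← h, hrr] at h2
      split_ifs at h1 h2 <;> omega
    · rw [hrr, hrr] at h
      by_cases h1 : i = j <;> by_cases h2 : i = j'
      · rw [← h1, ← h2]
      · rw [if_pos h1, if_neg h2] at h; omega
      · rw [if_neg h1, if_pos h2] at h; omega
      · rw [if_neg h1, if_neg h2] at h
        have : j = j' := Fin.ext (by omega)
        rw [this]
  have hrange : ∀ y : X ⊕ Fin n, y ∉ Set.range (Sum.inr : Fin n → X ⊕ Fin n) →
      ∃ x, y = Sum.inl x := by
    rintro (x | j) h
    · exact ⟨x, rfl⟩
    · exact absurd ⟨j, rfl⟩ h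
  have hX0 : ∃ x : X, True := by
    refine ⟨⟨fun i => if i = ⟨0, hn⟩ then N else 0, hXmk _ ?_⟩, trivial⟩
    simp
  have : Nonempty (Fin n) := ⟨⟨0, hn⟩⟩
  obtain ⟨B, hdom, hcol⟩ := scarf_lemma r hinj Sum.inr Sum.inr_injective
    (by
      rintro i (x | j) h
      · rw [hrl, hrr, if_pos rfl]; omega
      · have : i ≠ j := fun h' => h (by rw [h'])
        rw [hrr, hrr, if_pos rfl, if_neg this]; omega)
    (by
      intro i j y hij hy
      obtain ⟨x, rfl⟩ := hrange y hy
      have := hbig i x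
      rw [hrr, if_neg hij]
      omega)
    (by
      obtain ⟨x, -⟩ := hX0
      exact ⟨Sum.inl x, by simp⟩)
    (Sum.elim (fun x => c x.1) id) (fun i => rfl)
  have hC : ∀ (y : X), ∃ i, Sum.inr i ∉ B ∧ ∀ x, Sum.inl x ∈ B → y.1 i ≤ x.1 i := by
    intro y
    obtain ⟨i, hi⟩ := hdom (Sum.inl y)
    refine ⟨i, ?_, fun x hx => hmono i x y (hi _ hx)⟩
    intro hB
    have := hi _ hB
    rw [hrl, hrr, if_pos rfl] at this
    omega
  have hne : ∃ x0 : X, Sum.inl x0 ∈ B := by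
    obtain ⟨x, -⟩ := hX0
    obtain ⟨i, hi, -⟩ := hC x
    obtain ⟨y, hyB, hy⟩ := hcol i
    rcases y with x | j
    · exact ⟨x, hyB⟩
    · exfalso
      have : j = i := hy
      rw [this] at hyB
      exact hi hyB
  obtain ⟨x0, hx0⟩ := hne
  have hmin : ∀ i, ∃ m : X, Sum.inl m ∈ B ∧ ∀ x, Sum.inl x ∈ B → m.1 i ≤ x.1 i := by
    intro i
    obtain ⟨m, hm, hm'⟩ := Finset.exists_min_image
      (Finset.univ.filter (fun x : X => (Sum.inl x : X ⊕ Fin n) ∈ B)) (fun x => x.1 i)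
      ⟨x0, by simpa using hx0⟩
    simp only [Finset.mem_filter, Finset.mem_univ, true_and] at hm hm'
    exact ⟨m, hm, hm'⟩
  choose m hmB hm using hmin
  let ν : Fin n → ℕ := fun i => if (Sum.inr i : X ⊕ Fin n) ∉ B then (m i).1 i else 0
  let t : Fin n → ℕ := fun i => if (Sum.inr i : X ⊕ Fin n) ∉ B then 1 else 0
  have hνle : ∀ x, Sum.inl x ∈ B → ∀ i, ν i ≤ x.1 i := by
    intro x hx i
    by_cases h : (Sum.inr i : X ⊕ Fin n) ∉ B
    · simp only [ν, if_pos h]; exact hm i x hx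
    · simp only [ν, if_neg h]; exact Nat.zero_le _
  have htn : ∑ i, t i ≤ n := by
    calc ∑ i, t i ≤ ∑ i : Fin n, 1 := Finset.sum_le_sum (fun i _ => by
          simp only [t]; split_ifs <;> omega)
      _ = n := by simp
  have hbd : N < ∑ i, ν i + n := by
    by_contra hcon
    push Not at hcon
    obtain ⟨i1, hi1, -⟩ := hC x0
    have hle : ∑ i, (ν i + t i) ≤ N := by
      rw [Finset.sum_add_distrib]; omega
    have hy : ∑ i, (ν i + t i + if i = i1 then N - ∑ i, (ν i + t i) else 0) = N := by
      rw [Finset.sum_add_distrib (f := fun i => ν i + t i)]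
      simp only [Finset.sum_ite_eq', Finset.mem_univ, if_true]
      omega
    obtain ⟨i, hiB, hi⟩ := hC ⟨_, hXmk _ hy⟩
    have h1 := hi (m i) (hmB i)
    simp only [ν, t, if_pos hiB] at h1
    omega
  have hub : ∀ x, Sum.inl x ∈ B → ∀ j, x.1 j < ν j + n := by
    intro x hx j
    have h1 := hXsum x
    rw [← Finset.add_sum_erase _ _ (Finset.mem_univ j)] at h1
    rw [← Finset.add_sum_erase _ _ (Finset.mem_univ j)] at hbd
    have h2 : ∑ i ∈ Finset.univ.erase j, ν i ≤ ∑ i ∈ Finset.univ.erase j, x.1 i :=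
      Finset.sum_le_sum (fun i _ => hνle x hx i)
    omega
  refine ⟨x0.1, hXsum x0, fun i => ?_⟩
  by_cases hi : (Sum.inr i : X ⊕ Fin n) ∈ B
  · left
    have := hub x0 hx0 i
    simp only [ν, hi, not_true, if_false] at this
    omega
  · right
    obtain ⟨y, hyB, hy⟩ := hcol i
    rcases y with x | j
    · refine ⟨x.1, hXsum x, hy, fun j => ?_⟩
      have h1 := hub x hyB j
      have h2 := hub x0 hx0 j
      have h3 := hνle x hyB j
      have h4 := hνle x0 hx0 j
      omega
    · exfalso
      have : j = i := hy
      rw [this] at hyB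
      exact hi hyB

theorem brouwer_approx (n : ℕ) (hn : 0 < n) (f : (Fin n → ℝ) → (Fin n → ℝ))
    (hf : ContinuousOn f (stdSimplex ℝ (Fin n)))
    (hm : Set.MapsTo f (stdSimplex ℝ (Fin n)) (stdSimplex ℝ (Fin n))) (ε : ℝ) (hε : 0 < ε) :
    ∃ z ∈ stdSimplex ℝ (Fin n), ∀ i, z i ≤ f z i + ε := by
  have huc := (isCompact_stdSimplex ℝ (Fin n)).uniformContinuousOn_of_continuous hf
  rw [Metric.uniformContinuousOn_iff] at huc
  obtain ⟨δ, hδ, hu⟩ := huc (ε / 2) (by linarith)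
  obtain ⟨N, hN⟩ := exists_nat_gt ((n : ℝ) / min δ (ε / 2))
  have hmin : 0 < min δ (ε / 2) := lt_min hδ (by linarith)
  have hN0 : (0 : ℝ) < N := lt_of_le_of_lt (by positivity) hN
  have hnN : (n : ℝ) / N < min δ (ε / 2) := by
    rw [div_lt_iff₀ hmin] at hN
    rw [div_lt_iff₀ hN0]
    linarith
  have hnN1 := lt_of_lt_of_le hnN (min_le_left _ _)
  have hnN2 := lt_of_lt_of_le hnN (min_le_right _ _)
  let P : (Fin n → ℕ) → (Fin n → ℝ) := fun x i => (x i : ℝ) / N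
  have hP : ∀ x : Fin n → ℕ, ∑ i, x i = N → P x ∈ stdSimplex ℝ (Fin n) := by
    intro x hx
    refine ⟨fun i => by positivity, ?_⟩
    simp only [P]
    rw [← Finset.sum_div, ← Nat.cast_sum, hx, div_self hN0.ne']
  have hcol : ∀ x : Fin n → ℕ, ∃ i : Fin n, ∑ i, x i = N → P x i ≤ f (P x) i := by
    intro x
    by_cases hx : ∑ i, x i = N
    · obtain ⟨i, -, hi⟩ := Finset.exists_le_of_sum_le (s := (Finset.univ : Finset (Fin n)))
        (f := P x) (g := f (P x)) ⟨⟨0, hn⟩, Finset.mem_univ _⟩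
        (by rw [(hP x hx).2, (hm (hP x hx)).2])
      exact ⟨i, fun _ => hi⟩
    · exact ⟨⟨0, hn⟩, fun h => absurd h hx⟩
  choose c hc using hcol
  obtain ⟨x0, hx0, hg⟩ := grid_lemma n N hn c
  refine ⟨P x0, hP x0 hx0, fun i => ?_⟩
  rcases hg i with h | ⟨x, hx, hxi, hxx⟩
  · have h1 : P x0 i < n / N := by
      simp only [P]
      exact div_lt_div_of_pos_right (by exact_mod_cast h) hN0
    have h2 := (hm (hP x0 hx0)).1 i
    linarith
  · have hclose : ∀ j, |P x j - P x0 j| ≤ n / N := by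
      intro j
      simp only [P]
      rw [← sub_div, abs_div, abs_of_pos hN0]
      apply div_le_div_of_nonneg_right _ hN0.le
      obtain ⟨h1, h2⟩ := hxx j
      have h1' : (x j : ℝ) ≤ x0 j + n := by exact_mod_cast h1
      have h2' : (x0 j : ℝ) ≤ x j + n := by exact_mod_cast h2
      rw [abs_le]
      constructor <;> linarith
    have hd : dist (P x) (P x0) < δ := by
      rw [dist_pi_lt_iff hδ]
      intro j
      rw [Real.dist_eq]
      exact (hclose j).trans_lt hnN1
    have h3 := hu _ (hP x hx) _ (hP x0 hx0) hd
    have h4 := (dist_le_pi_dist (f (P x)) (f (P x0)) i).trans_lt h3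
    rw [Real.dist_eq] at h4
    have h5 := hc x hx
    rw [hxi] at h5
    have h6 := hclose i
    have h7 := abs_lt.1 h4
    have h8 := abs_le.1 h6
    linarith

theorem brouwer_stdSimplex (n : ℕ) (hn : 0 < n) (f : (Fin n → ℝ) → (Fin n → ℝ))
    (hf : ContinuousOn f (stdSimplex ℝ (Fin n)))
    (hm : Set.MapsTo f (stdSimplex ℝ (Fin n)) (stdSimplex ℝ (Fin n))) :
    ∃ z ∈ stdSimplex ℝ (Fin n), f z = z := by
  have hfi : ∀ i, ContinuousOn (fun z => f z i) (stdSimplex ℝ (Fin n)) :=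
    fun i => continuousOn_pi.1 hf i
  have hcont : ContinuousOn (fun z => ∑ i, max 0 (z i - f z i)) (stdSimplex ℝ (Fin n)) := by
    apply continuousOn_finsetSum
    intro i _
    exact continuousOn_const.sup (((continuous_apply i).continuousOn).sub (hfi i))
  obtain ⟨z1, hz1, -⟩ := brouwer_approx n hn f hf hm 1 one_pos
  obtain ⟨z, hz, hzmin⟩ := (isCompact_stdSimplex ℝ (Fin n)).exists_isMinOn ⟨z1, hz1⟩ hcont
  have hle : ∑ i, max 0 (z i - f z i) ≤ 0 := by
    apply le_of_forall_pos_le_add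
    intro ε hε
    have hn' : (0 : ℝ) < n := by exact_mod_cast hn
    obtain ⟨y, hy, hyi⟩ := brouwer_approx n hn f hf hm (ε / n) (by positivity)
    refine (hzmin hy).trans ?_
    calc ∑ i, max 0 (y i - f y i) ≤ ∑ _i : Fin n, ε / n :=
          Finset.sum_le_sum (fun i _ => max_le (by positivity) (by linarith [hyi i]))
      _ = 0 + ε := by
          rw [Finset.sum_const, Finset.card_univ, Fintype.card_fin, nsmul_eq_mul]
          field_simp
          simp
  have h0 : ∀ i, z i ≤ f z i := by
    intro i
    have h1 := Finset.single_le_sum (f := fun i => max 0 (z i - f z i))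
      (fun i _ => le_max_left _ _) (Finset.mem_univ i)
    have h2 := le_max_right 0 (z i - f z i)
    have h1' : max 0 (z i - f z i) ≤ ∑ i, max 0 (z i - f z i) := h1
    linarith
  refine ⟨z, hz, ?_⟩
  have h3 := (Finset.sum_eq_sum_iff_of_le (s := Finset.univ) (fun i _ => h0 i)).1
    (by rw [hz.2, (hm hz).2])
  exact funext (fun i => (h3 i (Finset.mem_univ i)).symm)

/-! ### A Ky Fan type inequality -/

theorem kyfan_finite {V : Type*} [NormedAddCommGroup V] [NormedSpace ℝ V] (K : Set V)
    (hconv : Convex ℝ K) (φ : V → V → ℝ) (hc : ∀ q, Continuous (fun p => φ p q))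
    (hconc : ∀ p, ConcaveOn ℝ K (φ p)) (h0 : ∀ p, φ p p ≤ 0) (n : ℕ) (hn : 0 < n)
    (q : Fin n → V) (hq : ∀ m, q m ∈ K) : ∃ p ∈ K, ∀ m, φ p (q m) ≤ 0 := by
  let P : (Fin n → ℝ) → V := fun l => ∑ m, l m • q m
  have hPc : Continuous P := by
    simp only [P]; fun_prop
  let g : Fin n → (Fin n → ℝ) → ℝ := fun m l => max 0 (φ (P l) (q m))
  have hgc : ∀ m, Continuous (g m) := fun m => continuous_const.max ((hc (q m)).comp hPc)
  have hg0 : ∀ m l, 0 ≤ g m l := fun m l => le_max_left _ _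
  let G : (Fin n → ℝ) → ℝ := fun l => ∑ m, g m l
  have hGc : Continuous G := continuous_finsetSum _ (fun m _ => hgc m)
  have hG0 : ∀ l, 0 ≤ G l := fun l => Finset.sum_nonneg (fun m _ => hg0 m l)
  let f : (Fin n → ℝ) → (Fin n → ℝ) := fun l m => (l m + g m l) / (1 + G l)
  have hfc : Continuous f := by
    apply continuous_pi
    intro m
    apply Continuous.div ((continuous_apply m).add (hgc m)) (continuous_const.add hGc)
    intro l
    have := hG0 l
    exact (by linarith : (0 : ℝ) < 1 + G l).ne'
  obtain ⟨l, hl, hfl⟩ := brouwer_stdSimplex n hn f hfc.continuousOn (by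
    intro l hl
    have hG := hG0 l
    refine ⟨fun m => ?_, ?_⟩
    · have h1 := hl.1 m
      have h2 := hg0 m l
      simp only [f]
      positivity
    · simp only [f]
      rw [← Finset.sum_div, Finset.sum_add_distrib, hl.2]
      exact div_self (by positivity))
  have hPK : P l ∈ K := hconv.sum_mem (fun m _ => hl.1 m) hl.2 (fun m _ => hq m)
  have hfix : ∀ m, l m * G l = g m l := by
    intro m
    have h1 := congrFun hfl m
    simp only [f] at h1
    have hG := hG0 l
    rw [div_eq_iff (by positivity)] at h1
    linarith
  have hle : ∑ m, l m • φ (P l) (q m) ≤ 0 :=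
    ((hconc (P l)).le_map_sum (fun m _ => hl.1 m) hl.2 (fun m _ => hq m)).trans (h0 (P l))
  have hterm : ∀ m, l m • φ (P l) (q m) = l m ^ 2 * G l ∨ G l = 0 := by
    intro m
    by_cases hG : G l = 0
    · exact Or.inr hG
    left
    have hGp : 0 < G l := lt_of_le_of_ne (hG0 l) (Ne.symm hG)
    rcases (hl.1 m).eq_or_lt with h | h
    · rw [← h]; simp
    · have h1 : 0 < g m l := by rw [← hfix m]; positivity
      have h2 : g m l = φ (P l) (q m) := by
        rcases max_choice 0 (φ (P l) (q m)) with h3 | h3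
        · exact absurd h3 h1.ne'
        · exact h3
      rw [smul_eq_mul, ← h2, ← hfix m]; ring
  have hGz : G l = 0 := by
    by_contra hG
    have hGp : 0 < G l := lt_of_le_of_ne (hG0 l) (Ne.symm hG)
    have h1 : ∑ m, l m ^ 2 * G l ≤ 0 := by
      rw [← Finset.sum_congr rfl (fun m _ => (hterm m).resolve_right hG)]
      exact hle
    have h2 := (Finset.sum_eq_zero_iff_of_nonneg (s := Finset.univ)
      (f := fun m => l m ^ 2 * G l) (fun m _ => by positivity)).1
      (le_antisymm h1 (Finset.sum_nonneg (fun m _ => by positivity)))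
    have h3 : ∀ m, l m = 0 := by
      intro m
      have := h2 m (Finset.mem_univ m)
      simpa [hG] using this
    have h4 := hl.2
    simp [h3] at h4
  refine ⟨P l, hPK, fun m => ?_⟩
  have h1 := hfix m
  rw [hGz, mul_zero] at h1
  have h2 : φ (P l) (q m) ≤ g m l := le_max_right _ _
  linarith

theorem kyfan {V : Type*} [NormedAddCommGroup V] [NormedSpace ℝ V] (K : Set V)
    (hcomp : IsCompact K) (hne : K.Nonempty)
    (hconv : Convex ℝ K) (φ : V → V → ℝ) (hc : ∀ q, Continuous (fun p => φ p q))
    (hconc : ∀ p, ConcaveOn ℝ K (φ p)) (h0 : ∀ p, φ p p ≤ 0) :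
    ∃ p ∈ K, ∀ q ∈ K, φ p q ≤ 0 := by
  have := hcomp.inter_iInter_nonempty (fun q : K => {p : V | φ p q ≤ 0})
    (fun q => isClosed_le (hc q) continuous_const) (by
      intro F
      rcases F.eq_empty_or_nonempty with rfl | hF
      · simpa using hne
      · obtain ⟨p, hp, hpq⟩ := kyfan_finite K hconv φ hc hconc h0 F.card
          (Finset.card_pos.2 hF) (fun m => ((F.equivFin.symm m : K) : V))
          (fun m => (F.equivFin.symm m : K).2)
        refine ⟨p, hp, ?_⟩
        simp only [Set.mem_iInter, Set.mem_ofPred_eq]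
        intro q hq
        have := hpq (F.equivFin ⟨q, hq⟩)
        simpa using this)
  obtain ⟨p, hp, hpq⟩ := this
  refine ⟨p, hp, fun q hq => ?_⟩
  exact Set.mem_iInter.1 hpq ⟨q, hq⟩

/-! ### A rational functional -/

theorem exists_rat_functional {T : Type*} [Fintype T] (x : T → ℝ) :
    ∃ g : ℝ →ₗ[ℚ] ℚ, g 1 = 1 ∧ ∀ t, 0 < x t → 0 < g (x t) := by
  let x' : Option T → ℝ := fun o => o.elim 1 x
  let W : Submodule ℚ ℝ := Submodule.span ℚ (Set.range x')
  have hfin : FiniteDimensional ℚ W := FiniteDimensional.span_of_finite ℚ (Set.finite_range x')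
  let b := Module.finBasis ℚ W
  have hx' : ∀ t, x' t ∈ W := fun t => Submodule.subset_span ⟨t, rfl⟩
  let U : Set (Fin (Module.finrank ℚ W) → ℝ) :=
    {c | ∀ t, 0 < x' t → 0 < ∑ i, ((b.repr ⟨x' t, hx' t⟩ i : ℚ) : ℝ) * c i}
  have hU : IsOpen U := by
    simp only [U, Set.ofPred_forall]
    refine isOpen_iInter_of_finite (fun t => isOpen_iInter_of_finite (fun _ => ?_))
    exact isOpen_lt continuous_const (by fun_prop)
  have hUne : U.Nonempty := by
    refine ⟨fun i => (b i : ℝ), fun t ht => ?_⟩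
    have h1 := congrArg (fun v : W => (v : ℝ)) (b.sum_repr ⟨x' t, hx' t⟩)
    simp only [Submodule.coe_sum, Submodule.coe_smul] at h1
    simp only [Rat.smul_def] at h1
    rw [h1]; exact ht
  have hdense : DenseRange (Pi.map (fun (_ : Fin (Module.finrank ℚ W)) (q : ℚ) => (q : ℝ))) :=
    DenseRange.piMap (fun _ => Rat.denseRange_cast)
  obtain ⟨c, hc⟩ := hdense.exists_mem_open hU hUne
  let g0 : W →ₗ[ℚ] ℚ := ∑ i, c i • b.coord i
  have hg0 : ∀ t, 0 < x' t → 0 < g0 ⟨x' t, hx' t⟩ := by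
    intro t ht
    have h1 := hc t ht
    simp only [Pi.map_apply] at h1
    have h2 : 0 < ∑ i, b.repr ⟨x' t, hx' t⟩ i * c i := by exact_mod_cast h1
    have h3 : g0 ⟨x' t, hx' t⟩ = ∑ i, b.repr ⟨x' t, hx' t⟩ i * c i := by
      simp only [g0, LinearMap.sum_apply, LinearMap.smul_apply, Module.Basis.coord_apply,
        smul_eq_mul]
      exact Finset.sum_congr rfl (fun i _ => mul_comm _ _)
    rw [h3]; exact h2
  obtain ⟨g1, hg1⟩ := LinearMap.exists_extend g0
  have hg1' : ∀ t, 0 < x' t → 0 < g1 (x' t) := by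
    intro t ht
    have h1 := hg0 t ht
    rw [← hg1] at h1
    exact h1
  have h1 : 0 < g1 1 := hg1' none one_pos
  refine ⟨(g1 1)⁻¹ • g1, ?_, ?_⟩
  · simp [h1.ne']
  · intro t ht
    have h2 : 0 < g1 (x t) := hg1' (some t) ht
    simp only [LinearMap.smul_apply, smul_eq_mul]
    positivity

/-! ### The penalized game -/

/-- The marginal of `w` at strategy `s` of player `j`. -/
noncomputable def mgl (j : Fin k) (s : S j) (w : (∀ j, S j) → ℝ) : ℝ :=
  ∑ e ∈ Finset.univ.filter (fun e : ∀ j, S j => e j = s), w e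

theorem mgl_nonneg (j : Fin k) (s : S j) (w : (∀ j, S j) → ℝ) (hw : ∀ e, 0 ≤ w e) :
    0 ≤ mgl j s w := Finset.sum_nonneg (fun e _ => hw e)

theorem mgl_add (j : Fin k) (s : S j) (v w : (∀ j, S j) → ℝ) :
    mgl j s (fun e => v e + w e) = mgl j s v + mgl j s w := Finset.sum_add_distrib

theorem mgl_mul (j : Fin k) (s : S j) (a : ℝ) (w : (∀ j, S j) → ℝ) :
    mgl j s (fun e => a * w e) = a * mgl j s w := (Finset.mul_sum _ _ _).symm

theorem mgl_continuous (j : Fin k) (s : S j) :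
    Continuous (mgl j s : ((∀ j, S j) → ℝ) → ℝ) := by
  unfold mgl; fun_prop

theorem sum_mgl (j : Fin k) (w : (∀ j, S j) → ℝ) : ∑ s, mgl j s w = ∑ e, w e := by
  unfold mgl
  exact Finset.sum_fiberwise _ _ _

/-- The product coupling. -/
theorem exists_coupling (p : ∀ j, S j → ℝ) (hp : ∀ j, IsDist (p j)) :
    ∃ v ∈ stdSimplex ℝ (∀ j, S j), ∀ j s, mgl j s v = p j s := by
  refine ⟨fun e => ∏ j, p j (e j), ⟨fun e => Finset.prod_nonneg (fun j _ => (hp j).1 _), ?_⟩, ?_⟩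
  · have h := Finset.prod_univ_sum (fun j => (Finset.univ : Finset (S j))) (fun j s => p j s)
    rw [Fintype.piFinset_univ] at h
    rw [← h]
    exact Finset.prod_eq_one (fun j _ => (hp j).2)
  · intro j s
    have h := Finset.prod_univ_sum
      (fun j' => (Finset.univ : Finset (S j')).filter (fun t => ∀ h : j' = j, h ▸ t = s))
      (fun j s => p j s)
    have h1 : Fintype.piFinset
        (fun j' => (Finset.univ : Finset (S j')).filter (fun t => ∀ h : j' = j, h ▸ t = s)) =
        Finset.univ.filter (fun e : ∀ j, S j => e j = s) := by
      ext e
      simp only [Fintype.mem_piFinset, Finset.mem_filter, Finset.mem_univ, true_and]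
      constructor
      · intro h; exact h j rfl
      · rintro h j' rfl; exact h
    rw [h1] at h
    unfold mgl
    rw [← h, Finset.prod_eq_single j]
    · have : (Finset.univ : Finset (S j)).filter (fun t => ∀ h : j = j, h ▸ t = s) = {s} := by
        ext t; simp
      rw [this, Finset.sum_singleton]
    · intro j' _ hj'
      have : (Finset.univ : Finset (S j')).filter (fun t => ∀ h : j' = j, h ▸ t = s) =
          Finset.univ := by
        ext t; simp [hj']
      rw [this]; exact (hp j').2
    · intro h; exact absurd (Finset.mem_univ j) h

/-- Penalized payoff of player `i` playing `v` against `w`. -/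
noncomputable def penal (u : ∀ _ : Fin k, (∀ j, S j) → ℝ) (L : ℝ) (i : Fin k)
    (v : (∀ j, S j) → ℝ) (w : Fin k → (∀ j, S j) → ℝ) : ℝ :=
  ∑ e, v e * u i e - L * ∑ j ∈ Finset.univ.filter (fun j => j ≠ i), ∑ s : S j,
    (mgl j s v - mgl j s (w j)) ^ 2

theorem penal_concave (u : ∀ _ : Fin k, (∀ j, S j) → ℝ) (L : ℝ) (hL : 0 ≤ L) (i : Fin k)
    (w : Fin k → (∀ j, S j) → ℝ) (x y : (∀ j, S j) → ℝ) (a b : ℝ) (ha : 0 ≤ a) (hb : 0 ≤ b)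
    (hab : a + b = 1) :
    a * penal u L i x w + b * penal u L i y w ≤ penal u L i (a • x + b • y) w := by
  have hm : ∀ (j : Fin k) (s : S j), mgl j s (a • x + b • y) = a * mgl j s x + b * mgl j s y := by
    intro j s
    rw [← mgl_mul, ← mgl_mul, ← mgl_add]; rfl
  have h1 : ∑ e, (a • x + b • y) e * u i e = a * ∑ e, x e * u i e + b * ∑ e, y e * u i e := by
    rw [Finset.mul_sum, Finset.mul_sum, ← Finset.sum_add_distrib]
    refine Finset.sum_congr rfl (fun e _ => ?_)
    simp only [Pi.add_apply, Pi.smul_apply, smul_eq_mul]; ring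
  have h2 : ∑ j ∈ Finset.univ.filter (fun j => j ≠ i), ∑ s : S j,
      (mgl j s (a • x + b • y) - mgl j s (w j)) ^ 2 ≤
      a * (∑ j ∈ Finset.univ.filter (fun j => j ≠ i), ∑ s : S j,
        (mgl j s x - mgl j s (w j)) ^ 2) +
      b * (∑ j ∈ Finset.univ.filter (fun j => j ≠ i), ∑ s : S j,
        (mgl j s y - mgl j s (w j)) ^ 2) := by
    simp only [Finset.mul_sum]
    rw [← Finset.sum_add_distrib]
    refine Finset.sum_le_sum (fun j _ => ?_)
    rw [← Finset.sum_add_distrib]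
    refine Finset.sum_le_sum (fun s _ => ?_)
    rw [hm]
    have hb' : b = 1 - a := by linarith
    have h3 : 0 ≤ a * b * (mgl j s x - mgl j s y) ^ 2 := by positivity
    subst hb'
    nlinarith [h3]
  unfold penal
  rw [h1]
  have h3 := mul_le_mul_of_nonneg_left h2 hL
  linarith

theorem penal_continuous (u : ∀ _ : Fin k, (∀ j, S j) → ℝ) (L : ℝ) (i : Fin k) :
    Continuous (fun z : ((∀ j, S j) → ℝ) × (Fin k → (∀ j, S j) → ℝ) => penal u L i z.1 z.2) := by
  unfold penal mgl
  fun_prop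

theorem penal_equilibrium [∀ j, Nonempty (S j)] (u : ∀ _ : Fin k, (∀ j, S j) → ℝ) (L : ℝ)
    (hL : 0 ≤ L) : ∃ w : Fin k → (∀ j, S j) → ℝ, (∀ i, w i ∈ stdSimplex ℝ (∀ j, S j)) ∧
      ∀ i, ∀ v ∈ stdSimplex ℝ (∀ j, S j), penal u L i v w ≤ penal u L i (w i) w := by
  let K : Set (Fin k → (∀ j, S j) → ℝ) := Set.univ.pi (fun _ => stdSimplex ℝ (∀ j, S j))
  have hne : (stdSimplex ℝ (∀ j, S j)).Nonempty := by
    obtain ⟨e⟩ : Nonempty (∀ j, S j) := inferInstance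
    exact ⟨_, single_mem_stdSimplex ℝ e⟩
  obtain ⟨w, hw, hmax⟩ := kyfan K (isCompact_univ_pi (fun _ => isCompact_stdSimplex ℝ _))
    (Set.univ_pi_nonempty_iff.2 (fun _ => hne))
    (convex_pi (fun _ _ => convex_stdSimplex ℝ _))
    (fun p q => ∑ i, (penal u L i (q i) p - penal u L i (p i) p))
    (by
      intro q
      refine continuous_finsetSum _ (fun i _ => ?_)
      have hc1 : Continuous (fun p : Fin k → (∀ j, S j) → ℝ => penal u L i (q i) p) :=
        (penal_continuous u L i).comp (continuous_const.prodMk continuous_id)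
      have hc2 : Continuous (fun p : Fin k → (∀ j, S j) → ℝ => penal u L i (p i) p) :=
        (penal_continuous u L i).comp
          (Continuous.prodMk (f := fun p : Fin k → (∀ j, S j) → ℝ => p i)
            (continuous_apply i) continuous_id)
      exact hc1.sub hc2)
    (by
      intro p
      refine ⟨convex_pi (fun _ _ => convex_stdSimplex ℝ _), ?_⟩
      intro x _ y _ a b ha hb hab
      simp only [smul_eq_mul]
      rw [Finset.mul_sum, Finset.mul_sum, ← Finset.sum_add_distrib]
      refine Finset.sum_le_sum (fun i _ => ?_)
      have h := penal_concave u L hL i p (x i) (y i) a b ha hb hab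
      have hb' : b = 1 - a := by linarith
      simp only [Pi.add_apply, Pi.smul_apply]
      have h2 : a * penal u L i (p i) p + b * penal u L i (p i) p = penal u L i (p i) p := by
        rw [← add_mul, hab, one_mul]
      linarith)
    (by intro p; simp)
  have hw' : ∀ i, w i ∈ stdSimplex ℝ (∀ j, S j) := fun i => hw i (Set.mem_univ i)
  refine ⟨w, hw', fun i v hv => ?_⟩
  have h := hmax (Function.update w i v) (by
    intro i' _
    by_cases h : i' = i
    · subst h; simpa using hv
    · simpa [h] using hw' i')
  rw [Finset.sum_eq_single i] at h
  · simp only [Function.update_self] at h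
    linarith
  · intro i' _ hi'
    simp [hi']
  · intro h; exact absurd (Finset.mem_univ i) h

/-- Existence of a (coupled) equilibrium over the reals. -/
theorem real_equilibrium [∀ j, Nonempty (S j)] (u : ∀ _ : Fin k, (∀ j, S j) → ℝ) :
    ∃ w : Fin k → (∀ j, S j) → ℝ, (∀ i, w i ∈ stdSimplex ℝ (∀ j, S j)) ∧
      (∀ i j, j ≠ i → ∀ s : S j, mgl j s (w i) = mgl j s (w j)) ∧
      ∀ i (d : (∀ j, S j) → ℝ), (∀ e, 0 ≤ w i e + d e) → ∑ e, d e = 0 →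
        (∀ j, j ≠ i → ∀ s : S j, mgl j s d = 0) → ∑ e, d e * u i e ≤ 0 := by
  have hex := fun n : ℕ => penal_equilibrium u ((n : ℝ) + 1) (by positivity)
  choose W hW hopt using hex
  obtain ⟨w, hw, ψ, hψ, hlim⟩ := (isCompact_univ_pi
    (fun _ : Fin k => isCompact_stdSimplex ℝ (∀ j, S j))).tendsto_subseq
    (x := W) (fun n i _ => hW n i)
  have hlim1 : ∀ i, Filter.Tendsto (fun n => W (ψ n) i) Filter.atTop (nhds (w i)) :=
    fun i => (tendsto_pi_nhds.1 hlim) i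
  have hlim2 : ∀ i e, Filter.Tendsto (fun n => W (ψ n) i e) Filter.atTop (nhds (w i e)) :=
    fun i e => (tendsto_pi_nhds.1 (hlim1 i)) e
  refine ⟨w, fun i => hw i (Set.mem_univ i), ?_, ?_⟩
  · intro i j hji s
    let U : ℝ := ∑ e, |u i e|
    have hU : ∀ v ∈ stdSimplex ℝ (∀ j, S j), |∑ e, v e * u i e| ≤ U := by
      intro v hv
      refine (Finset.abs_sum_le_sum_abs _ _).trans (Finset.sum_le_sum (fun e _ => ?_))
      rw [abs_mul, abs_of_nonneg (hv.1 e)]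
      have h1 : v e ≤ 1 := by
        rw [← hv.2]
        exact Finset.single_le_sum (f := v) (fun e _ => hv.1 e) (Finset.mem_univ e)
      exact mul_le_of_le_one_left (abs_nonneg _) h1
    have hbound : ∀ n : ℕ, (mgl j s (W n i) - mgl j s (W n j)) ^ 2 ≤ (2 * U) * (1 / ((n : ℝ) + 1)) := by
      intro n
      obtain ⟨v, hv, hvm⟩ := exists_coupling (fun j s => mgl j s (W n j)) (fun j =>
        ⟨fun s => mgl_nonneg j s _ (hW n j).1, by rw [sum_mgl]; exact (hW n j).2⟩)
      have h1 := hopt n i v hv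
      unfold penal at h1
      simp only [hvm, sub_self] at h1
      have h2 : (mgl j s (W n i) - mgl j s (W n j)) ^ 2 ≤
          ∑ j ∈ Finset.univ.filter (fun j => j ≠ i), ∑ s : S j,
            (mgl j s (W n i) - mgl j s (W n j)) ^ 2 := by
        refine (Finset.single_le_sum
          (f := fun s : S j => (mgl j s (W n i) - mgl j s (W n j)) ^ 2)
          (fun s _ => sq_nonneg _) (Finset.mem_univ s)).trans ?_
        exact Finset.single_le_sum
          (f := fun j => ∑ s : S j, (mgl j s (W n i) - mgl j s (W n j)) ^ 2)
          (fun j _ => Finset.sum_nonneg (fun s _ => sq_nonneg _)) (by simp [hji])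
      have h3 := abs_le.1 (hU v hv)
      have h4 := abs_le.1 (hU _ (hW n i))
      have hn : (0 : ℝ) < (n : ℝ) + 1 := by positivity
      have h5 := mul_le_mul_of_nonneg_left h2 hn.le
      have h6 : ∑ j ∈ Finset.univ.filter (fun j => j ≠ i), ∑ s : S j, (0 : ℝ) ^ 2 = 0 := by simp
      rw [h6] at h1
      rw [mul_one_div, le_div_iff₀ hn]
      linarith
    have ht1 : Filter.Tendsto (fun n => (mgl j s (W (ψ n) i) - mgl j s (W (ψ n) j)) ^ 2)
        Filter.atTop (nhds ((mgl j s (w i) - mgl j s (w j)) ^ 2)) :=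
      ((((mgl_continuous j s).tendsto _).comp (hlim1 i)).sub
        (((mgl_continuous j s).tendsto _).comp (hlim1 j))).pow 2
    have ht2 : Filter.Tendsto (fun n => (2 * U) * (1 / ((ψ n : ℝ) + 1)))
        Filter.atTop (nhds ((2 * U) * 0)) :=
      (tendsto_one_div_add_atTop_nhds_zero_nat.comp hψ.tendsto_atTop).const_mul _
    have h := le_of_tendsto_of_tendsto' ht1 ht2 (fun n => hbound (ψ n))
    rw [mul_zero] at h
    have h' := pow_eq_zero_iff (two_ne_zero) |>.1 (le_antisymm h (sq_nonneg _))
    linarith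
  · intro i d hd hd0 hdm
    have hev : ∀ᶠ n in Filter.atTop, ∀ e, 0 ≤ W (ψ n) i e + (1 / 2) * d e := by
      rw [Filter.eventually_all]
      intro e
      by_cases hde : 0 ≤ d e
      · refine Filter.Eventually.of_forall (fun n => ?_)
        have := (hW (ψ n) i).1 e
        positivity
      · push Not at hde
        have h1 : -(1 / 2) * d e < w i e := by linarith [hd e]
        filter_upwards [(hlim2 i e).eventually (lt_mem_nhds h1)] with n hn
        linarith
    obtain ⟨n, hn⟩ := hev.exists
    have hv : (fun e => W (ψ n) i e + (1 / 2) * d e) ∈ stdSimplex ℝ (∀ j, S j) := by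
      refine ⟨hn, ?_⟩
      rw [Finset.sum_add_distrib, ← Finset.mul_sum, hd0, (hW (ψ n) i).2]
      norm_num
    have h1 := hopt (ψ n) i _ hv
    unfold penal at h1
    have h2 : ∑ j ∈ Finset.univ.filter (fun j => j ≠ i), ∑ s : S j,
        (mgl j s (fun e => W (ψ n) i e + (1 / 2) * d e) - mgl j s (W (ψ n) j)) ^ 2 =
        ∑ j ∈ Finset.univ.filter (fun j => j ≠ i), ∑ s : S j,
        (mgl j s (W (ψ n) i) - mgl j s (W (ψ n) j)) ^ 2 := by
      refine Finset.sum_congr rfl (fun j hj => Finset.sum_congr rfl (fun s _ => ?_))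
      rw [mgl_add, mgl_mul, hdm j (Finset.mem_filter.1 hj).2]
      ring
    rw [h2] at h1
    have h3 : ∑ e, (W (ψ n) i e + (1 / 2) * d e) * u i e =
        ∑ e, W (ψ n) i e * u i e + (1 / 2) * ∑ e, d e * u i e := by
      rw [Finset.mul_sum, ← Finset.sum_add_distrib]
      exact Finset.sum_congr rfl (fun e _ => by ring)
    rw [h3] at h1
    linarith



/-- For any multi-player matrix game with all rational utilities, there exists
a personalized equilibrium in which every probability is rational. -/
theorem rational_personalized_equilibrium_exists [∀ j, Nonempty (S j)]
    (u : ∀ _ : Fin k, (∀ j, S j) → ℝ)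
    (hrat : ∀ i e, ∃ q : ℚ, u i e = (q : ℝ)) :
    ∃ p : ∀ j, S j → ℝ, PersonalizedEq u p ∧
      ∀ (j : Fin k) (s : S j), ∃ q : ℚ, p j s = (q : ℝ) := by
  obtain ⟨w, hw, hcons, hopt⟩ := real_equilibrium u
  obtain ⟨g, hg1, hgpos⟩ := exists_rat_functional (fun t : Fin k × (∀ j, S j) => w t.1 t.2)
  let w' : Fin k → (∀ j, S j) → ℝ := fun i e => ((g (w i e) : ℚ) : ℝ)
  have hw'0 : ∀ i e, 0 ≤ w' i e := by
    intro i e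
    rcases ((hw i).1 e).eq_or_lt with h | h
    · simp [w', ← h]
    · have : 0 < g (w i e) := hgpos (i, e) h
      simp only [w']
      exact_mod_cast this.le
  have hw'1 : ∀ i, ∑ e, w' i e = 1 := by
    intro i
    simp only [w']
    rw [← Rat.cast_sum, ← map_sum, (hw i).2, hg1, Rat.cast_one]
  have hmg : ∀ i j (s : S j), mgl j s (w' i) = ((g (mgl j s (w i)) : ℚ) : ℝ) := by
    intro i j s
    unfold mgl
    simp only [w']
    rw [← Rat.cast_sum, ← map_sum]
  let p : ∀ j, S j → ℝ := fun j s => mgl j s (w' j)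
  have hp : ∀ j, IsDist (p j) := fun j =>
    ⟨fun s => mgl_nonneg j s _ (hw'0 j), by simp only [p]; rw [sum_mgl]; exact hw'1 j⟩
  have hmg' : ∀ i j (s : S j), mgl j s (w' i) = p j s := by
    intro i j s
    by_cases h : j = i
    · subst h; rfl
    · simp only [p]
      rw [hmg, hmg, hcons i j h]
  refine ⟨p, ⟨hp, fun i q hq => ?_⟩, fun j s => ⟨g (mgl j s (w j)), hmg j j s⟩⟩
  have hupd : ∀ j, IsDist (Function.update p i q j) := by
    intro j
    by_cases h : j = i
    · subst h; simpa using hq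
    · simpa [h] using hp j
  have hlow : ∑ e, w' i e * u i e ≤ ppayoff (u i) p := by
    unfold ppayoff
    refine le_csSup ⟨∑ e, |u i e|, ?_⟩ ⟨w' i, hw'0 i, fun j s => hmg' i j s, rfl⟩
    rintro _ ⟨v, hv0, hvm, rfl⟩
    have hv1 : ∑ e, v e = 1 := by
      rw [← sum_mgl i v, ← (hp i).2]
      exact Finset.sum_congr rfl (fun s _ => hvm i s)
    refine Finset.sum_le_sum (fun e _ => ?_)
    have h1 : v e ≤ 1 := by
      rw [← hv1]
      exact Finset.single_le_sum (f := v) (fun e _ => hv0 e) (Finset.mem_univ e)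
    calc v e * u i e ≤ v e * |u i e| := mul_le_mul_of_nonneg_left (le_abs_self _) (hv0 e)
      _ ≤ |u i e| := mul_le_of_le_one_left (abs_nonneg _) h1
  refine le_trans ?_ hlow
  unfold ppayoff
  apply csSup_le
  · obtain ⟨v, hv, hvm⟩ := exists_coupling _ hupd
    exact ⟨_, v, hv.1, fun j s => hvm j s, rfl⟩
  rintro _ ⟨v, hv0, hvm, rfl⟩
  have hv1 : ∑ e, v e = 1 := by
    rw [← sum_mgl i v, ← (hupd i).2]
    exact Finset.sum_congr rfl (fun s _ => hvm i s)
  have hev : ∀ᶠ ε : ℝ in nhdsWithin 0 (Set.Ioi 0), ∀ e, 0 ≤ w i e + ε * (v e - w' i e) := by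
    rw [Filter.eventually_all]
    intro e
    rcases ((hw i).1 e).eq_or_lt with h | h
    · filter_upwards [self_mem_nhdsWithin] with ε hε
      have h0 : w' i e = 0 := by simp [w', ← h]
      rw [← h, h0, sub_zero, zero_add]
      exact mul_nonneg (le_of_lt hε) (hv0 e)
    · have hcont : Continuous (fun ε : ℝ => w i e + ε * (v e - w' i e)) := by fun_prop
      have ht := hcont.tendsto 0
      simp only [zero_mul, add_zero] at ht
      have h2 := (ht.mono_left (nhdsWithin_le_nhds (s := Set.Ioi 0))).eventually (lt_mem_nhds h)
      filter_upwards [h2] with ε hε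
      exact le_of_lt hε
  obtain ⟨ε, hε, hεpos⟩ := (hev.and self_mem_nhdsWithin).exists
  have hεpos' : 0 < ε := hεpos
  have hfin := hopt i (fun e => ε * (v e - w' i e)) hε (by
    rw [← Finset.mul_sum, Finset.sum_sub_distrib, hv1, hw'1, sub_self, mul_zero]) (by
    intro j hj s
    rw [mgl_mul]
    have h1 : mgl j s (fun e => v e - w' i e) = mgl j s v - mgl j s (w' i) :=
      Finset.sum_sub_distrib _ _
    have h2 : mgl j s v = p j s := by
      have := hvm j s
      rw [Function.update_of_ne hj] at this
      exact this
    rw [h1, h2, hmg', sub_self, mul_zero])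
  have h3 : ∑ e, ε * (v e - w' i e) * u i e =
      ε * (∑ e, v e * u i e - ∑ e, w' i e * u i e) := by
    rw [← Finset.sum_sub_distrib, Finset.mul_sum]
    exact Finset.sum_congr rfl (fun e _ => by ring)
  rw [h3] at hfin
  have h4 : ∑ e, v e * u i e - ∑ e, w' i e * u i e ≤ 0 := by
    by_contra hcon
    push Not at hcon
    have := mul_pos hεpos' hcon
    linarith
  linarith
end
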